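/- arXiv:1810.06154 — 3 statements merged into one kernel-verified Lean document; each statement's English description precedes it below -/
import Mathlib

section
/- For a family of planar curves evolving by ∂_t γ = Vν, the energy E = (1/2)∫_γ k_s² ds satisfies dE/dt = ∫_γ V(−k_ssss − k² k_ss + (1/2) k k_s²) ds; hence the steepest descent L²-gradient flow of E has velocity V = k_ssss + k² k_ss − (1/2) k k_s². -/
open Real MeasureTheory

/-- Rotation by `π/2` in the plane (sending the unit tangent to the unit normal). -/
noncomputable def rot2 (p : EuclideanSpace ℝ (Fin 2)) : EuclideanSpace ℝ (Fin 2) :=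
  (WithLp.equiv 2 (Fin 2 → ℝ)).symm ![-p 1, p 0]

/-- Arclength derivative `∂_s = v⁻¹ ∂_u` in a parametrization with speed `v`. -/
noncomputable def aderiv (v : ℝ → ℝ) (f : ℝ → ℝ) : ℝ → ℝ := fun u => (v u)⁻¹ * deriv f u

/-- The ideal-curve Euler–Lagrange operator `K = k_ssss + k² k_ss − ½ k k_s²`,
expressed via arclength derivatives in a parametrization with speed `v`. -/
noncomputable def Kop (v k : ℝ → ℝ) (u : ℝ) : ℝ :=
  (aderiv v)^[4] k u + (k u) ^ 2 * (aderiv v)^[2] k u - (1 / 2) * k u * (aderiv v k u) ^ 2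

open scoped ContDiff
open Function (uncurry)

section TwoParameter

variable {F : Type*} [NormedAddCommGroup F] [NormedSpace ℝ F]

/-- The derivative of a two-parameter family in its first variable. -/
noncomputable def timeDeriv (f : ℝ → ℝ → F) : ℝ → ℝ → F := fun t u => deriv (fun t' => f t' u) t

/-- The derivative of a two-parameter family in its second variable. -/
noncomputable def spaceDeriv (f : ℝ → ℝ → F) : ℝ → ℝ → F := fun t u => deriv (f t) u

variable {f : ℝ → ℝ → F}

theorem hasDerivAt_time_fderiv (hf : ContDiff ℝ ∞ (uncurry f)) (t u : ℝ) :
    HasDerivAt (fun t' => f t' u) (fderiv ℝ (uncurry f) (t, u) (1, 0)) t :=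
  HasFDerivAt.comp_hasDerivAt (f := fun t' => (t', u)) t
    ((hf.differentiable (by simp)) (t, u)).hasFDerivAt
    ((hasDerivAt_id t).prodMk (hasDerivAt_const t u))

theorem hasDerivAt_space_fderiv (hf : ContDiff ℝ ∞ (uncurry f)) (t u : ℝ) :
    HasDerivAt (f t) (fderiv ℝ (uncurry f) (t, u) (0, 1)) u :=
  HasFDerivAt.comp_hasDerivAt (f := fun u' => (t, u')) u
    ((hf.differentiable (by simp)) (t, u)).hasFDerivAt
    ((hasDerivAt_const u t).prodMk (hasDerivAt_id u))

theorem hasDerivAt_timeDeriv (hf : ContDiff ℝ ∞ (uncurry f)) (t u : ℝ) :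
    HasDerivAt (fun t' => f t' u) (timeDeriv f t u) t :=
  (hasDerivAt_time_fderiv hf t u).differentiableAt.hasDerivAt

theorem hasDerivAt_spaceDeriv (hf : ContDiff ℝ ∞ (uncurry f)) (t u : ℝ) :
    HasDerivAt (f t) (spaceDeriv f t u) u :=
  (hasDerivAt_space_fderiv hf t u).differentiableAt.hasDerivAt

theorem uncurry_timeDeriv (hf : ContDiff ℝ ∞ (uncurry f)) :
    uncurry (timeDeriv f) = fun p => fderiv ℝ (uncurry f) p (1, 0) :=
  funext fun p => (hasDerivAt_time_fderiv hf p.1 p.2).deriv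

theorem uncurry_spaceDeriv (hf : ContDiff ℝ ∞ (uncurry f)) :
    uncurry (spaceDeriv f) = fun p => fderiv ℝ (uncurry f) p (0, 1) :=
  funext fun p => (hasDerivAt_space_fderiv hf p.1 p.2).deriv

theorem contDiff_timeDeriv (hf : ContDiff ℝ ∞ (uncurry f)) :
    ContDiff ℝ ∞ (uncurry (timeDeriv f)) := by
  rw [uncurry_timeDeriv hf]
  exact (hf.fderiv_right (m := ∞) (by simp)).clm_apply contDiff_const

theorem contDiff_spaceDeriv (hf : ContDiff ℝ ∞ (uncurry f)) :
    ContDiff ℝ ∞ (uncurry (spaceDeriv f)) := by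
  rw [uncurry_spaceDeriv hf]
  exact (hf.fderiv_right (m := ∞) (by simp)).clm_apply contDiff_const

theorem timeDeriv_spaceDeriv_comm (hf : ContDiff ℝ ∞ (uncurry f)) (t u : ℝ) :
    timeDeriv (spaceDeriv f) t u = spaceDeriv (timeDeriv f) t u := by
  have hd : DifferentiableAt ℝ (fderiv ℝ (uncurry f)) (t, u) :=
    (hf.fderiv_right (m := ∞) (by simp)).differentiable (by simp) _
  have h1 := (hasDerivAt_time_fderiv (contDiff_spaceDeriv hf) t u).deriv
  have h2 := (hasDerivAt_space_fderiv (contDiff_timeDeriv hf) t u).deriv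
  have hsymm : IsSymmSndFDerivAt ℝ (uncurry f) (t, u) :=
    hf.contDiffAt.isSymmSndFDerivAt (by
      rw [minSmoothness_of_isRCLikeNormedField]; exact WithTop.coe_le_coe.2 le_top)
  rw [uncurry_spaceDeriv hf, fderiv_clm_apply hd (by fun_prop)] at h1
  rw [uncurry_timeDeriv hf, fderiv_clm_apply hd (by fun_prop)] at h2
  simp only [fderiv_fun_const, Pi.zero_apply, ContinuousLinearMap.comp_zero, zero_add,
    ContinuousLinearMap.flip_apply] at h1 h2
  exact (h1.trans (hsymm _ _)).trans h2.symm

theorem periodic_spaceDeriv {c : ℝ} (h : ∀ t, Function.Periodic (f t) c) (t : ℝ) :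
    Function.Periodic (spaceDeriv f t) c := fun u => by
  simp only [spaceDeriv]
  rw [← deriv_comp_add_const]
  simp only [h t _]

theorem periodic_timeDeriv {c : ℝ} (h : ∀ t, Function.Periodic (f t) c) (t : ℝ) :
    Function.Periodic (timeDeriv f t) c := fun u => by
  simp only [timeDeriv, h _ u]

/-- Differentiation under the integral sign for smooth integrands. -/
theorem hasDerivAt_integral_of_contDiff (hf : ContDiff ℝ ∞ (uncurry f)) (a b t : ℝ) :
    HasDerivAt (fun t' => ∫ u in a..b, f t' u) (∫ u in a..b, timeDeriv f t u) t := by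
  have hc : ∀ t', Continuous (f t') := fun t' =>
    hf.continuous.comp (g := uncurry f) (f := fun u => (t', u)) (by fun_prop)
  have hc' : Continuous (uncurry (timeDeriv f)) := (contDiff_timeDeriv hf).continuous
  obtain ⟨C, hC⟩ := ((isCompact_closedBall t 1).prod
    (isCompact_uIcc (a := a) (b := b))).exists_bound_of_continuousOn hc'.continuousOn
  refine (intervalIntegral.hasDerivAt_integral_of_dominated_loc_of_deriv_le
    (F' := timeDeriv f) (bound := fun _ => C) (Metric.closedBall_mem_nhds t one_pos)
    (Filter.Eventually.of_forall fun t' => (hc t').aestronglyMeasurable)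
    ((hc t).intervalIntegrable a b)
    (hc'.comp (g := uncurry (timeDeriv f)) (f := fun u => (t, u))
      (by fun_prop)).aestronglyMeasurable
    (Filter.Eventually.of_forall fun u hu t' ht' =>
      hC (t', u) ⟨ht', Set.uIoc_subset_uIcc hu⟩)
    intervalIntegrable_const
    (Filter.Eventually.of_forall fun u _ t' _ => hasDerivAt_timeDeriv hf t' u)).2

end TwoParameter

/-- Arclength derivative of a two-parameter family. -/
noncomputable def arcDeriv (v f : ℝ → ℝ → ℝ) : ℝ → ℝ → ℝ := fun t => aderiv (v t) (f t)

section ArcDeriv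

variable {v f : ℝ → ℝ → ℝ}

theorem contDiff_arcDeriv (hv : ContDiff ℝ ∞ (uncurry v)) (hpos : ∀ t u, 0 < v t u)
    (hf : ContDiff ℝ ∞ (uncurry f)) : ContDiff ℝ ∞ (uncurry (arcDeriv v f)) :=
  (hv.inv fun p => (hpos p.1 p.2).ne').mul (contDiff_spaceDeriv hf)

theorem spaceDeriv_eq_mul_arcDeriv (hpos : ∀ t u, 0 < v t u) (t u : ℝ) :
    spaceDeriv f t u = v t u * arcDeriv v f t u :=
  (mul_inv_cancel_left₀ (hpos t u).ne' _).symm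

theorem hasDerivAt_arcDeriv (hpos : ∀ t u, 0 < v t u) (hf : ContDiff ℝ ∞ (uncurry f))
    (t u : ℝ) : HasDerivAt (f t) (v t u * arcDeriv v f t u) u :=
  spaceDeriv_eq_mul_arcDeriv (f := f) hpos t u ▸ hasDerivAt_spaceDeriv hf t u

theorem periodic_arcDeriv {c : ℝ} (hv : ∀ t, Function.Periodic (v t) c)
    (hf : ∀ t, Function.Periodic (f t) c) (t : ℝ) : Function.Periodic (arcDeriv v f t) c :=
  fun u => congrArg₂ (fun x y : ℝ => x⁻¹ * y) (hv t u) (periodic_spaceDeriv hf t u)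

/-- If the length element evolves by `∂ₜ v = -k V v`, then
`∂ₜ ∂ₛ f = ∂ₛ ∂ₜ f + k V ∂ₛ f`. -/
theorem timeDeriv_arcDeriv {k V : ℝ → ℝ → ℝ} (hv : ContDiff ℝ ∞ (uncurry v))
    (hpos : ∀ t u, 0 < v t u) (hf : ContDiff ℝ ∞ (uncurry f))
    (hvt : ∀ t u, timeDeriv v t u = -(k t u * V t u * v t u)) (t u : ℝ) :
    timeDeriv (arcDeriv v f) t u
      = arcDeriv v (timeDeriv f) t u + k t u * V t u * arcDeriv v f t u := by
  have hne := (hpos t u).ne'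
  have h1 := ((hasDerivAt_timeDeriv hv t u).mul
    (hasDerivAt_timeDeriv (contDiff_arcDeriv hv hpos hf) t u))
  have h2 := hasDerivAt_timeDeriv (contDiff_spaceDeriv hf) t u
  have h3 := h1.unique (h2.congr_of_eventuallyEq (Filter.Eventually.of_forall fun t' =>
    (spaceDeriv_eq_mul_arcDeriv (f := f) hpos t' u).symm))
  rw [timeDeriv_spaceDeriv_comm hf, spaceDeriv_eq_mul_arcDeriv hpos, hvt] at h3
  apply mul_left_cancel₀ hne
  linear_combination h3

end ArcDeriv

/-- Evolution of length element and curvature, in terms of the components `(X, Y)` of the unit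
tangent of a curve `(x, y)` moving with normal velocity `V`. -/
theorem evolution_speed_curvature {x y X Y v k V : ℝ → ℝ → ℝ}
    (hx : ContDiff ℝ ∞ (uncurry x)) (hy : ContDiff ℝ ∞ (uncurry y))
    (hX : ContDiff ℝ ∞ (uncurry X)) (hY : ContDiff ℝ ∞ (uncurry Y))
    (hv : ContDiff ℝ ∞ (uncurry v)) (hk : ContDiff ℝ ∞ (uncurry k))
    (hV : ContDiff ℝ ∞ (uncurry V)) (hpos : ∀ t u, 0 < v t u)
    (hunit : ∀ t u, X t u ^ 2 + Y t u ^ 2 = 1)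
    (hxu : ∀ t u, spaceDeriv x t u = v t u * X t u)
    (hyu : ∀ t u, spaceDeriv y t u = v t u * Y t u)
    (hXu : ∀ t u, spaceDeriv X t u = -(v t u * k t u * Y t u))
    (hYu : ∀ t u, spaceDeriv Y t u = v t u * k t u * X t u)
    (hxt : ∀ t u, timeDeriv x t u = -(V t u * Y t u))
    (hyt : ∀ t u, timeDeriv y t u = V t u * X t u) :
    (∀ t u, timeDeriv v t u = -(k t u * V t u * v t u)) ∧
    (∀ t u, timeDeriv k t u = arcDeriv v (arcDeriv v V) t u + k t u ^ 2 * V t u) := by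
  have ext2 : ∀ {f g : ℝ → ℝ → ℝ}, (∀ t u, f t u = g t u) → f = g :=
    fun h => funext fun t => funext (h t)
  have key : ∀ t u, timeDeriv v t u = -(k t u * V t u * v t u) ∧
      timeDeriv X t u = -(arcDeriv v V t u * Y t u) ∧
      timeDeriv Y t u = arcDeriv v V t u * X t u := by
    intro t u
    have dX := hasDerivAt_timeDeriv hX t u
    have dY := hasDerivAt_timeDeriv hY t u
    have dv := hasDerivAt_timeDeriv hv t u
    have e1 := timeDeriv_spaceDeriv_comm hx t u
    have e2 := timeDeriv_spaceDeriv_comm hy t u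
    have dV := hasDerivAt_arcDeriv hpos hV t u
    rw [ext2 hxu, ext2 hxt] at e1
    rw [ext2 hyu, ext2 hyt] at e2
    have l1 : timeDeriv (fun t u => v t u * X t u) t u = _ := (dv.mul dX).deriv
    have l2 : timeDeriv (fun t u => v t u * Y t u) t u = _ := (dv.mul dY).deriv
    have r1 : spaceDeriv (fun t u => -(V t u * Y t u)) t u = _ :=
      (dV.mul (hasDerivAt_spaceDeriv hY t u)).neg.deriv
    have r2 : spaceDeriv (fun t u => V t u * X t u) t u = _ :=
      (dV.mul (hasDerivAt_spaceDeriv hX t u)).deriv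
    rw [l1, r1, hYu] at e1
    rw [l2, r2, hXu] at e2
    have e3 := ((dX.pow 2).add (dY.pow 2)).unique
      ((hasDerivAt_const t (1 : ℝ)).congr_of_eventuallyEq
        (Filter.Eventually.of_forall fun t' => hunit t' u))
    simp only [Nat.cast_ofNat, Nat.add_one_sub_one, pow_one] at e3
    have hu := hunit t u
    have hne := (hpos t u).ne'
    have hvt : timeDeriv v t u = -(k t u * V t u * v t u) := by
      linear_combination X t u * e1 + Y t u * e2 - v t u / 2 * e3
        - (timeDeriv v t u + k t u * V t u * v t u) * hu
    refine ⟨hvt, mul_left_cancel₀ hne ?_, mul_left_cancel₀ hne ?_⟩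
    · linear_combination e1 - X t u * hvt
    · linear_combination e2 - Y t u * hvt
  refine ⟨fun t u => (key t u).1, fun t u => ?_⟩
  have dX := hasDerivAt_timeDeriv hX t u
  have dY := hasDerivAt_timeDeriv hY t u
  have dw := (hasDerivAt_timeDeriv hv t u).mul (hasDerivAt_timeDeriv hk t u)
  have ds := hasDerivAt_arcDeriv hpos (contDiff_arcDeriv hv hpos hV) t u
  have e1 := timeDeriv_spaceDeriv_comm hX t u
  have e2 := timeDeriv_spaceDeriv_comm hY t u
  rw [ext2 hXu, ext2 fun t u => (key t u).2.1] at e1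
  rw [ext2 hYu, ext2 fun t u => (key t u).2.2] at e2
  have l1 : timeDeriv (fun t u => -(v t u * k t u * Y t u)) t u = _ := (dw.mul dY).neg.deriv
  have l2 : timeDeriv (fun t u => v t u * k t u * X t u) t u = _ := (dw.mul dX).deriv
  have r1 : spaceDeriv (fun t u => -(arcDeriv v V t u * Y t u)) t u = _ :=
    (ds.mul (hasDerivAt_spaceDeriv hY t u)).neg.deriv
  have r2 : spaceDeriv (fun t u => arcDeriv v V t u * X t u) t u = _ :=
    (ds.mul (hasDerivAt_spaceDeriv hX t u)).deriv
  rw [l1, r1, hYu, (key t u).2.2, (key t u).1] at e1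
  rw [l2, r2, hXu, (key t u).2.1, (key t u).1] at e2
  simp only [Pi.mul_apply] at e1 e2
  have hu := hunit t u
  apply mul_left_cancel₀ (hpos t u).ne'
  linear_combination X t u * e2 - Y t u * e1
    - (v t u * timeDeriv k t u - k t u ^ 2 * V t u * v t u
      - v t u * arcDeriv v (arcDeriv v V) t u) * hu

/-- First variation of `½ ∫ k_s² ds` for smooth periodic data evolving by `∂ₜ v = -k V v` and
`∂ₜ k = V_ss + k² V`. -/
theorem deriv_energy_of_evolution {v k V : ℝ → ℝ → ℝ}
    (hv : ContDiff ℝ ∞ (uncurry v)) (hk : ContDiff ℝ ∞ (uncurry k))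
    (hV : ContDiff ℝ ∞ (uncurry V)) (hpos : ∀ t u, 0 < v t u)
    (pv : ∀ t, Function.Periodic (v t) 1) (pk : ∀ t, Function.Periodic (k t) 1)
    (pV : ∀ t, Function.Periodic (V t) 1)
    (hvt : ∀ t u, timeDeriv v t u = -(k t u * V t u * v t u))
    (hkt : ∀ t u, timeDeriv k t u = arcDeriv v (arcDeriv v V) t u + k t u ^ 2 * V t u) (t : ℝ) :
    deriv (fun t' => (1 / 2) * ∫ u in (0:ℝ)..1, (aderiv (v t') (k t') u) ^ 2 * v t' u) t
      = ∫ u in (0:ℝ)..1, V t u * (-(Kop (v t) (k t) u)) * v t u := by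
  have sk1 := contDiff_arcDeriv hv hpos hk
  have sk2 := contDiff_arcDeriv hv hpos sk1
  have sk3 := contDiff_arcDeriv hv hpos sk2
  have sk4 := contDiff_arcDeriv hv hpos sk3
  have sV1 := contDiff_arcDeriv hv hpos hV
  have sV2 := contDiff_arcDeriv hv hpos sV1
  have pk1 := periodic_arcDeriv pv pk
  have pk2 := periodic_arcDeriv pv pk1
  have pk3 := periodic_arcDeriv pv pk2
  have pV1 := periodic_arcDeriv pv pV
  have pV2 := periodic_arcDeriv pv pV1
  set k1 := arcDeriv v k with hk1
  set k2 := arcDeriv v k1 with hk2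
  set k3 := arcDeriv v k2 with hk3
  set k4 := arcDeriv v k3 with hk4
  set V1 := arcDeriv v V with hV1
  set V2 := arcDeriv v V1 with hV2
  have hktfun : timeDeriv k = fun t u => V2 t u + k t u ^ 2 * V t u :=
    funext fun t => funext (hkt t)
  have hk1t : ∀ u, timeDeriv k1 t u
      = arcDeriv v V2 t u + k t u ^ 2 * V1 t u + 3 * k t u * V t u * k1 t u := by
    intro u
    rw [hk1, timeDeriv_arcDeriv hv hpos hk hvt, hktfun]
    have h := ((hasDerivAt_arcDeriv hpos sV2 t u).add
      (((hasDerivAt_arcDeriv hpos hk t u).pow 2).mul (hasDerivAt_arcDeriv hpos hV t u))).deriv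
    have h' : arcDeriv v (fun t u => V2 t u + k t u ^ 2 * V t u) t u
        = arcDeriv v V2 t u + k t u ^ 2 * V1 t u + 2 * k t u * V t u * k1 t u := by
      refine (inv_mul_eq_iff_eq_mul₀ (hpos t u).ne').2 (Eq.trans h ?_)
      simp only [Pi.pow_apply, Nat.cast_ofNat, Nat.add_one_sub_one, pow_one, ← hk1, ← hV1]
      ring
    rw [h', ← hk1]
    ring
  have sE : ContDiff ℝ ∞ (uncurry fun t u => k1 t u ^ 2 * v t u) := (sk1.pow 2).mul hv
  have hE := (hasDerivAt_integral_of_contDiff sE 0 1 t).const_mul (1 / 2 : ℝ)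
  refine hE.deriv.trans ?_
  rw [← intervalIntegral.integral_const_mul, ← sub_eq_zero]
  -- the boundary term of the integrations by parts
  have dG : ∀ u, HasDerivAt
      (fun u => k1 t u * V2 t u - k2 t u * V1 t u + k3 t u * V t u + k t u ^ 2 * k1 t u * V t u)
      (1 / 2 * timeDeriv (fun t u => k1 t u ^ 2 * v t u) t u
        - V t u * (-(Kop (v t) (k t) u)) * v t u) u := by
    intro u
    have d : HasDerivAt (k t) (v t u * k1 t u) u := hasDerivAt_arcDeriv hpos hk t u
    have d1 : HasDerivAt (k1 t) (v t u * k2 t u) u := hasDerivAt_arcDeriv hpos sk1 t u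
    have d2 : HasDerivAt (k2 t) (v t u * k3 t u) u := hasDerivAt_arcDeriv hpos sk2 t u
    have d3 : HasDerivAt (k3 t) (v t u * k4 t u) u := hasDerivAt_arcDeriv hpos sk3 t u
    have D : HasDerivAt (V t) (v t u * V1 t u) u := hasDerivAt_arcDeriv hpos hV t u
    have D1 : HasDerivAt (V1 t) (v t u * V2 t u) u := hasDerivAt_arcDeriv hpos sV1 t u
    have D2 := hasDerivAt_arcDeriv hpos sV2 t u
    have hEt : timeDeriv (fun t u => k1 t u ^ 2 * v t u) t u = _ :=
      (((hasDerivAt_timeDeriv sk1 t u).pow 2).mul (hasDerivAt_timeDeriv hv t u)).deriv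
    have hK : Kop (v t) (k t) u = k4 t u + k t u ^ 2 * k2 t u - 1 / 2 * k t u * k1 t u ^ 2 := rfl
    rw [hEt, hK]
    refine ((((d1.mul D2).sub (d2.mul D1)).add (d3.mul D)).add
      (((d.pow 2).mul d1).mul D)).congr_deriv ?_
    simp only [Pi.pow_apply, Pi.mul_apply, Nat.cast_ofNat, Nat.add_one_sub_one, pow_one,
      hk1t, hvt]
    ring
  have cont : ∀ {f : ℝ → ℝ → ℝ}, ContDiff ℝ ∞ (uncurry f) → Continuous (f t) :=
    fun hf => hf.continuous.comp (g := uncurry _) (f := fun u => (t, u)) (by fun_prop)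
  have c1 : Continuous fun u => 1 / 2 * timeDeriv (fun t u => k1 t u ^ 2 * v t u) t u :=
    continuous_const.mul (cont (contDiff_timeDeriv sE))
  have c2 : Continuous fun u => V t u * (-(Kop (v t) (k t) u)) * v t u :=
    ((cont hV).mul (((cont sk4).add (((cont hk).pow 2).mul (cont sk2))).sub
      ((continuous_const.mul (cont hk)).mul ((cont sk1).pow 2))).neg).mul (cont hv)
  rw [← intervalIntegral.integral_sub (c1.intervalIntegrable _ _) (c2.intervalIntegrable _ _),
    intervalIntegral.integral_eq_sub_of_hasDerivAt (fun u _ => dG u)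
      ((c1.sub c2).intervalIntegrable _ _), (pk t).eq, (pk1 t).eq, (pk2 t).eq, (pk3 t).eq,
    (pV t).eq, (pV1 t).eq, (pV2 t).eq, sub_self]

/-- For a family of closed planar curves (parametrized over ℝ/ℤ)
evolving by `∂_t γ = Vν`, the energy `E = ½∫ k_s² ds` satisfies
`dE/dt = ∫ V·(−k_ssss − k²k_ss + ½ k k_s²) ds`; hence the steepest descent
`L²`-gradient flow of `E` has velocity `V = k_ssss + k²k_ss − ½ k k_s²`. -/
theorem first_variation_of_energy
    (γ : ℝ → ℝ → EuclideanSpace ℝ (Fin 2)) (τ : ℝ → ℝ → EuclideanSpace ℝ (Fin 2))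
    (v k V : ℝ → ℝ → ℝ)
    (hγ : ContDiff ℝ (⊤ : ℕ∞) (Function.uncurry γ))
    (hV : ContDiff ℝ (⊤ : ℕ∞) (Function.uncurry V))
    (hclosed : ∀ t, Function.Periodic (γ t) 1)
    (hvpos : ∀ t u, 0 < v t u)
    (hv : ∀ t u, v t u = ‖deriv (γ t) u‖)
    (hτ : ∀ t u, deriv (γ t) u = v t u • τ t u)
    (hfrenet : ∀ t u, deriv (τ t) u = (v t u * k t u) • rot2 (τ t u))
    (hflow : ∀ t u, deriv (fun t' => γ t' u) t = V t u • rot2 (τ t u)) :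
    ∀ t : ℝ,
      deriv (fun t' => (1 / 2) * ∫ u in (0:ℝ)..1, (aderiv (v t') (k t') u) ^ 2 * v t' u) t
        = ∫ u in (0:ℝ)..1, V t u * (-(Kop (v t) (k t) u)) * v t u := by
  have contDiff_coord : ∀ {f : ℝ → ℝ → EuclideanSpace ℝ (Fin 2)} (i : Fin 2),
      ContDiff ℝ ∞ (uncurry f) → ContDiff ℝ ∞ (uncurry fun t u => f t u i) :=
    fun i hf => contDiff_euclidean.1 hf i
  have hasDerivAt_coord : ∀ {f : ℝ → EuclideanSpace ℝ (Fin 2)} {f' : EuclideanSpace ℝ (Fin 2)}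
      {r : ℝ} (i : Fin 2), HasDerivAt f f' r → HasDerivAt (fun r => f r i) (f' i) r :=
    fun i hf => (EuclideanSpace.proj i : EuclideanSpace ℝ (Fin 2) →L[ℝ] ℝ).hasFDerivAt
      |>.comp_hasDerivAt _ hf
  have rot0 : ∀ p : EuclideanSpace ℝ (Fin 2), rot2 p 0 = -p 1 := fun _ => rfl
  have rot1 : ∀ p : EuclideanSpace ℝ (Fin 2), rot2 p 1 = p 0 := fun _ => rfl
  have sγu := contDiff_spaceDeriv hγ
  have hne : ∀ p : ℝ × ℝ, uncurry (spaceDeriv γ) p ≠ 0 := fun p h => by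
    have := hvpos p.1 p.2
    rw [hv, show deriv (γ p.1) p.2 = 0 from h, norm_zero] at this
    exact this.false
  have sv : ContDiff ℝ ∞ (uncurry v) := by
    rw [show uncurry v = fun p => ‖uncurry (spaceDeriv γ) p‖ from funext fun p => hv p.1 p.2]
    exact sγu.norm ℝ hne
  have hτeq : ∀ t u, τ t u = (v t u)⁻¹ • spaceDeriv γ t u := fun t u => by
    rw [spaceDeriv, hτ, inv_smul_smul₀ (hvpos t u).ne']
  have sτ : ContDiff ℝ ∞ (uncurry τ) := by
    rw [show uncurry τ = fun p => (uncurry v p)⁻¹ • uncurry (spaceDeriv γ) p from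
      funext fun p => hτeq p.1 p.2]
    exact (sv.inv fun p => (hvpos p.1 p.2).ne').smul sγu
  have hunit : ∀ t u, τ t u 0 ^ 2 + τ t u 1 ^ 2 = 1 := fun t u => by
    have h : ‖τ t u‖ = 1 := by
      rw [hτeq, norm_smul, spaceDeriv, ← hv, norm_inv, Real.norm_of_nonneg (hvpos t u).le,
        inv_mul_cancel₀ (hvpos t u).ne']
    have h2 := EuclideanSpace.norm_sq_eq (τ t u)
    simpa [h, Fin.sum_univ_two] using h2.symm
  have pγu := periodic_spaceDeriv hclosed
  have pv : ∀ t, Function.Periodic (v t) 1 := fun t u => by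
    rw [hv, hv]; exact congrArg norm (pγu t u)
  have pτ : ∀ t, Function.Periodic (τ t) 1 := fun t u => by
    rw [hτeq, hτeq, pγu t u, pv t u]
  have sX := contDiff_coord 0 sτ
  have sY := contDiff_coord 1 sτ
  have hxu : ∀ (i : Fin 2) t u, spaceDeriv (fun t u => γ t u i) t u = v t u * τ t u i :=
    fun i t u => by
      have h := hasDerivAt_coord i (hasDerivAt_spaceDeriv hγ t u)
      rw [spaceDeriv, hτ] at h
      exact h.deriv
  have hxt : ∀ (i : Fin 2) t u,
      timeDeriv (fun t u => γ t u i) t u = V t u * rot2 (τ t u) i := fun i t u => by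
    have h := hasDerivAt_coord i (hasDerivAt_timeDeriv hγ t u)
    rw [timeDeriv, hflow] at h
    exact h.deriv
  have hXu : ∀ (i : Fin 2) t u,
      spaceDeriv (fun t u => τ t u i) t u = v t u * k t u * rot2 (τ t u) i := fun i t u => by
    have h := hasDerivAt_coord i (hasDerivAt_spaceDeriv sτ t u)
    rw [spaceDeriv, hfrenet] at h
    exact h.deriv
  have hkeq : ∀ t u, k t u = (v t u)⁻¹ * (τ t u 0 * spaceDeriv (fun t u => τ t u 1) t u
      - τ t u 1 * spaceDeriv (fun t u => τ t u 0) t u) := fun t u => by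
    rw [hXu, hXu, rot0, rot1, eq_inv_mul_iff_mul_eq₀ (hvpos t u).ne']
    linear_combination (-(v t u * k t u)) * hunit t u
  have hVeq : ∀ t u, V t u = τ t u 0 * timeDeriv (fun t u => γ t u 1) t u
      - τ t u 1 * timeDeriv (fun t u => γ t u 0) t u := fun t u => by
    rw [hxt, hxt, rot0, rot1]
    linear_combination (-V t u) * hunit t u
  have sk : ContDiff ℝ ∞ (uncurry k) := by
    rw [show k = _ from funext fun t => funext (hkeq t)]
    exact (sv.inv fun p => (hvpos p.1 p.2).ne').mul
      ((sX.mul (contDiff_spaceDeriv sY)).sub (sY.mul (contDiff_spaceDeriv sX)))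
  have coord_periodic : ∀ {f : ℝ → ℝ → EuclideanSpace ℝ (Fin 2)} (i : Fin 2),
      (∀ t, Function.Periodic (f t) 1) → ∀ t, Function.Periodic (fun u => f t u i) 1 :=
    fun i h t u => congrArg (· i) (h t u)
  have pk : ∀ t, Function.Periodic (k t) 1 := fun t u => by
    rw [hkeq, hkeq, pv t u, pτ t u, periodic_spaceDeriv (coord_periodic 0 pτ) t u,
      periodic_spaceDeriv (coord_periodic 1 pτ) t u]
  have pV : ∀ t, Function.Periodic (V t) 1 := fun t u => by
    rw [hVeq, hVeq, pτ t u, periodic_timeDeriv (coord_periodic 0 hclosed) t u,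
      periodic_timeDeriv (coord_periodic 1 hclosed) t u]
  obtain ⟨hvt, hkt⟩ := evolution_speed_curvature (contDiff_coord 0 hγ) (contDiff_coord 1 hγ)
    sX sY sv sk hV hvpos hunit (hxu 0) (hxu 1)
    (fun t u => by rw [hXu, rot0, mul_neg]) (fun t u => by rw [hXu, rot1])
    (fun t u => by rw [hxt, rot0, mul_neg]) (fun t u => by rw [hxt, rot1])
  exact deriv_energy_of_evolution sv sk hV hvpos pv pk pV hvt hkt
end

section
/- The ideal curve flow with smooth closed immersed initial data exists for all time: the maximal existence time T of the solution to ∂_t γ = (k_ssss + k² k_ss − (1/2)k k_s²) ν is infinite. -/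
open Real MeasureTheory ENNReal

/-- The set of times `[0, T)` for an extended-real final time `T`. -/
def timeSet (T : ℝ≥0∞) : Set ℝ := {t : ℝ | 0 ≤ t ∧ ENNReal.ofReal t < T}

/-- Smooth real functions of period one. -/
structure SmoothPeriodic (f : ℝ → ℝ) : Prop where
  contDiff : ContDiff ℝ (⊤ : ℕ∞) f
  periodic : Function.Periodic f 1

namespace SmoothPeriodic

variable {f g v : ℝ → ℝ}

theorem continuous (hf : SmoothPeriodic f) : Continuous f := hf.contDiff.continuous

theorem differentiable (hf : SmoothPeriodic f) : Differentiable ℝ f :=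
  hf.contDiff.differentiable (by simp)

theorem const (c : ℝ) : SmoothPeriodic fun _ => c := ⟨contDiff_const, fun _ => rfl⟩

theorem add (hf : SmoothPeriodic f) (hg : SmoothPeriodic g) :
    SmoothPeriodic fun u => f u + g u :=
  ⟨hf.contDiff.add hg.contDiff, hf.periodic.add hg.periodic⟩

theorem sub (hf : SmoothPeriodic f) (hg : SmoothPeriodic g) :
    SmoothPeriodic fun u => f u - g u :=
  ⟨hf.contDiff.sub hg.contDiff, hf.periodic.sub hg.periodic⟩

theorem mul (hf : SmoothPeriodic f) (hg : SmoothPeriodic g) :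
    SmoothPeriodic fun u => f u * g u :=
  ⟨hf.contDiff.mul hg.contDiff, hf.periodic.mul hg.periodic⟩

theorem pow (hf : SmoothPeriodic f) (n : ℕ) : SmoothPeriodic fun u => f u ^ n :=
  ⟨hf.contDiff.pow n, fun u => by simp only [hf.periodic u]⟩

theorem deriv (hf : SmoothPeriodic f) : SmoothPeriodic (deriv f) := by
  refine ⟨(contDiff_infty_iff_deriv.1 hf.contDiff).2, fun u => ?_⟩
  rw [← deriv_comp_add_const]
  congr 1
  exact funext hf.periodic

theorem aderiv (hv : SmoothPeriodic v) (hpos : ∀ u, 0 < v u) (hf : SmoothPeriodic f) :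
    SmoothPeriodic (aderiv v f) :=
  ⟨(hv.contDiff.inv fun u => (hpos u).ne').mul hf.deriv.contDiff,
    fun u => by simp only [_root_.aderiv, hv.periodic u, hf.deriv.periodic u]⟩

end SmoothPeriodic

section Aderiv

variable {v f g : ℝ → ℝ}

theorem aderiv_add (hf : SmoothPeriodic f) (hg : SmoothPeriodic g) :
    aderiv v (fun u => f u + g u) = fun u => aderiv v f u + aderiv v g u := by
  funext u
  simp only [aderiv]
  rw [deriv_fun_add (hf.differentiable u) (hg.differentiable u)]
  ring

theorem aderiv_mul (hf : SmoothPeriodic f) (hg : SmoothPeriodic g) :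
    aderiv v (fun u => f u * g u) = fun u => aderiv v f u * g u + f u * aderiv v g u := by
  funext u
  simp only [aderiv]
  rw [deriv_fun_mul (hf.differentiable u) (hg.differentiable u)]
  ring

theorem aderiv_const (c : ℝ) : aderiv v (fun _ => c) = fun _ => 0 := by
  funext u
  simp [aderiv]

end Aderiv

/-- Integral over one period against the arclength element of speed `v`. -/
noncomputable def arcIntegral (v f : ℝ → ℝ) : ℝ := ∫ u in (0 : ℝ)..1, f u * v u

section ArcIntegral

variable {v f g : ℝ → ℝ}

theorem arcIntegral_add (hv : Continuous v) (hf : Continuous f) (hg : Continuous g) :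
    arcIntegral v (fun u => f u + g u) = arcIntegral v f + arcIntegral v g := by
  simp only [arcIntegral, add_mul]
  exact intervalIntegral.integral_add ((hf.mul hv).intervalIntegrable _ _)
    ((hg.mul hv).intervalIntegrable _ _)

theorem arcIntegral_const_mul (c : ℝ) :
    arcIntegral v (fun u => c * f u) = c * arcIntegral v f := by
  rw [arcIntegral, arcIntegral, ← intervalIntegral.integral_const_mul]
  exact intervalIntegral.integral_congr fun u _ => mul_assoc _ _ _

theorem arcIntegral_mono (hv : Continuous v) (hpos : ∀ u, 0 < v u) (hf : Continuous f)
    (hg : Continuous g) (h : ∀ u ∈ Set.Icc (0 : ℝ) 1, f u ≤ g u) :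
    arcIntegral v f ≤ arcIntegral v g :=
  intervalIntegral.integral_mono_on zero_le_one ((hf.mul hv).intervalIntegrable _ _)
    ((hg.mul hv).intervalIntegrable _ _) fun u hu =>
      mul_le_mul_of_nonneg_right (h u hu) (hpos u).le

theorem arcIntegral_nonneg (hpos : ∀ u, 0 < v u) (h : ∀ u, 0 ≤ f u) : 0 ≤ arcIntegral v f :=
  intervalIntegral.integral_nonneg zero_le_one fun u _ => mul_nonneg (h u) (hpos u).le

theorem arcIntegral_one_pos (hv : Continuous v) (hpos : ∀ u, 0 < v u) :
    0 < arcIntegral v fun _ => 1 := by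
  simp only [arcIntegral, one_mul]
  exact intervalIntegral.intervalIntegral_pos_of_pos (hv.intervalIntegrable _ _) hpos one_pos

theorem arcIntegral_aderiv (hpos : ∀ u, 0 < v u) (hf : SmoothPeriodic f) :
    arcIntegral v (aderiv v f) = 0 := by
  have h : arcIntegral v (aderiv v f) = ∫ u in (0 : ℝ)..1, deriv f u :=
    intervalIntegral.integral_congr fun u _ => by
      have := (hpos u).ne'
      simp only [aderiv]
      field_simp
  rw [h, intervalIntegral.integral_deriv_eq_sub (fun u _ => hf.differentiable u)
    (hf.deriv.continuous.intervalIntegrable _ _)]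
  have := hf.periodic 0
  rw [zero_add] at this
  rw [this, sub_self]

theorem arcIntegral_aderiv_mul (hv : SmoothPeriodic v) (hpos : ∀ u, 0 < v u)
    (hf : SmoothPeriodic f) (hg : SmoothPeriodic g) :
    arcIntegral v (fun u => aderiv v f u * g u) =
      -arcIntegral v (fun u => f u * aderiv v g u) := by
  have h := arcIntegral_aderiv hpos (hf.mul hg)
  rw [aderiv_mul hf hg, arcIntegral_add hv.continuous ((hv.aderiv hpos hf).mul hg).continuous
    (hf.mul (hv.aderiv hpos hg)).continuous] at h
  linarith

theorem arcIntegral_mul_sq_le (hv : Continuous v) (hpos : ∀ u, 0 < v u)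
    (hf : Continuous f) (hg : Continuous g) :
    arcIntegral v (fun u => f u * g u) ^ 2 ≤
      arcIntegral v (fun u => f u ^ 2) * arcIntegral v (fun u => g u ^ 2) := by
  have h : ∀ x : ℝ, 0 ≤ arcIntegral v (fun u => g u ^ 2) * (x * x) +
      2 * arcIntegral v (fun u => f u * g u) * x + arcIntegral v (fun u => f u ^ 2) := by
    intro x
    have h0 : 0 ≤ arcIntegral v (fun u => (f u + x * g u) ^ 2) :=
      arcIntegral_nonneg hpos fun u => sq_nonneg _
    have h1 : (fun u => (f u + x * g u) ^ 2) =
        fun u => (x * x * g u ^ 2 + 2 * x * (f u * g u)) + f u ^ 2 := by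
      funext u; ring
    rw [h1, arcIntegral_add hv (by fun_prop) (by fun_prop),
      arcIntegral_add hv (by fun_prop) (by fun_prop), arcIntegral_const_mul,
      arcIntegral_const_mul] at h0
    linarith
  have := discrim_le_zero h
  rw [discrim] at this
  linarith

/-- The `L²` norm with respect to arclength. -/
noncomputable def arcNorm (v f : ℝ → ℝ) : ℝ := √(arcIntegral v fun u => f u ^ 2)

theorem arcNorm_nonneg : 0 ≤ arcNorm v f := Real.sqrt_nonneg _

theorem sq_arcNorm (hpos : ∀ u, 0 < v u) :
    arcNorm v f ^ 2 = arcIntegral v fun u => f u ^ 2 :=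
  Real.sq_sqrt (arcIntegral_nonneg hpos fun _ => sq_nonneg _)

theorem arcNorm_le_of_sq_le {c : ℝ} (hc : 0 ≤ c)
    (h : arcIntegral v (fun u => f u ^ 2) ≤ c ^ 2) : arcNorm v f ≤ c :=
  Real.sqrt_le_iff.2 ⟨hc, h⟩

theorem abs_arcIntegral_mul_le (hv : Continuous v) (hpos : ∀ u, 0 < v u)
    (hf : Continuous f) (hg : Continuous g) :
    |arcIntegral v (fun u => f u * g u)| ≤ arcNorm v f * arcNorm v g := by
  apply abs_le_of_sq_le_sq _ (mul_nonneg arcNorm_nonneg arcNorm_nonneg)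
  rw [mul_pow, sq_arcNorm hpos, sq_arcNorm hpos]
  exact arcIntegral_mul_sq_le hv hpos hf hg

theorem arcNorm_add_le (hv : Continuous v) (hpos : ∀ u, 0 < v u)
    (hf : Continuous f) (hg : Continuous g) :
    arcNorm v (fun u => f u + g u) ≤ arcNorm v f + arcNorm v g := by
  apply arcNorm_le_of_sq_le (add_nonneg arcNorm_nonneg arcNorm_nonneg)
  have h1 : (fun u => (f u + g u) ^ 2) =
      fun u => (f u ^ 2 + 2 * (f u * g u)) + g u ^ 2 := by
    funext u; ring
  rw [h1, arcIntegral_add hv (by fun_prop) (by fun_prop),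
    arcIntegral_add hv (by fun_prop) (by fun_prop),
    arcIntegral_const_mul, ← sq_arcNorm hpos, ← sq_arcNorm hpos]
  have := (abs_le.1 (abs_arcIntegral_mul_le hv hpos hf hg)).2
  nlinarith

theorem arcNorm_mul_le (hv : Continuous v) (hpos : ∀ u, 0 < v u)
    (hf : Continuous f) (hg : Continuous g) {c : ℝ} (hc : 0 ≤ c)
    (h : ∀ u ∈ Set.Icc (0 : ℝ) 1, |f u| ≤ c) :
    arcNorm v (fun u => f u * g u) ≤ c * arcNorm v g := by
  apply arcNorm_le_of_sq_le (mul_nonneg hc arcNorm_nonneg)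
  rw [mul_pow, sq_arcNorm hpos, ← arcIntegral_const_mul]
  refine arcIntegral_mono hv hpos (by fun_prop) (by fun_prop) fun u hu => ?_
  rw [mul_pow]
  exact mul_le_mul_of_nonneg_right (sq_le_sq' (abs_le.1 (h u hu)).1 (abs_le.1 (h u hu)).2)
    (sq_nonneg _)

theorem arcNorm_const (c : ℝ) :
    arcNorm v (fun _ => c) = |c| * √(arcIntegral v fun _ => 1) := by
  have h : (arcIntegral v fun _ => c ^ 2) = c ^ 2 * arcIntegral v fun _ => 1 := by
    rw [← arcIntegral_const_mul, mul_one]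
  rw [arcNorm, h, Real.sqrt_mul (sq_nonneg c), Real.sqrt_sq_eq_abs]

theorem sq_arcNorm_aderiv_le (hv : SmoothPeriodic v) (hpos : ∀ u, 0 < v u)
    (hf : SmoothPeriodic f) :
    arcNorm v (aderiv v f) ^ 2 ≤ arcNorm v f * arcNorm v (aderiv v (aderiv v f)) := by
  have h := arcIntegral_aderiv_mul hv hpos hf (hv.aderiv hpos hf)
  have h2 := abs_arcIntegral_mul_le hv.continuous hpos hf.continuous
    (hv.aderiv hpos (hv.aderiv hpos hf)).continuous
  rw [sq_arcNorm hpos]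
  simp only [sq]
  rw [h]
  exact (neg_le_abs _).trans h2

/-- Distance from the mean value is controlled by the arclength derivative. -/
theorem abs_sub_mean_le (hv : SmoothPeriodic v) (hpos : ∀ u, 0 < v u)
    (hf : SmoothPeriodic f) {c : ℝ}
    (hc : arcIntegral v f = c * arcIntegral v fun _ => 1) {u : ℝ} (hu : u ∈ Set.Icc (0 : ℝ) 1) :
    |f u - c| ≤ √(arcIntegral v fun _ => 1) * arcNorm v (aderiv v f) := by
  set B := √(arcIntegral v fun _ => 1) * arcNorm v (aderiv v f) with hB
  have hf' := hv.aderiv hpos hf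
  have hcont : Continuous fun u => |deriv f u| := hf.deriv.continuous.abs
  have hvar : (∫ w in (0 : ℝ)..1, |deriv f w|) ≤ B := by
    have e1 : (∫ w in (0 : ℝ)..1, |deriv f w|) = arcIntegral v fun u => |aderiv v f u| :=
      intervalIntegral.integral_congr fun w _ => by
        have h0 := hpos w
        simp only [aderiv, abs_mul, abs_inv, abs_of_pos h0]
        field_simp
    have e2 := abs_arcIntegral_mul_le hv.continuous hpos (continuous_const (y := (1 : ℝ)))
      hf'.continuous.abs
    simp only [arcNorm, one_mul, one_pow, sq_abs] at e2
    rw [e1]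
    exact (le_abs_self _).trans e2
  have hosc : ∀ w ∈ Set.Icc (0 : ℝ) 1, |f u - f w| ≤ B := by
    intro w hw
    refine le_trans ?_ hvar
    rw [← intervalIntegral.integral_deriv_eq_sub (fun x _ => hf.differentiable x)
      (hf.deriv.continuous.intervalIntegrable _ _)]
    refine (intervalIntegral.norm_integral_le_integral_norm_uIoc
      (f := deriv f) (μ := volume)).trans ?_
    rw [intervalIntegral.integral_of_le zero_le_one]
    refine setIntegral_mono_set ?_ (Filter.Eventually.of_forall fun x => abs_nonneg _) ?_
    · exact (hcont.integrableOn_Icc).mono_set Set.Ioc_subset_Icc_self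
    · exact (Set.Ioc_subset_Ioc (le_min hw.1 hu.1) (max_le hw.2 hu.2)).eventuallyLE
  have hL := arcIntegral_one_pos hv.continuous hpos
  have e2 : (f u - c) * (arcIntegral v fun _ => 1) = arcIntegral v fun w => f u - f w := by
    have : (fun w => f u - f w) = fun w => f u * 1 + (-1) * f w := by funext w; ring
    rw [this, arcIntegral_add hv.continuous continuous_const
      (SmoothPeriodic.mul (SmoothPeriodic.const _) hf).continuous, arcIntegral_const_mul, arcIntegral_const_mul, hc]
    ring
  have hc1 : Continuous fun w => f u - f w := ((SmoothPeriodic.const _).sub hf).continuous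
  have up := arcIntegral_mono hv.continuous hpos hc1 (continuous_const (y := B * 1))
    fun w hw => (le_abs_self _).trans ((hosc w hw).trans_eq (mul_one B).symm)
  have lo := arcIntegral_mono hv.continuous hpos (continuous_const (y := (-B) * 1)) hc1
    fun w hw => (mul_one (-B)).trans_le (neg_le_of_abs_le (hosc w hw))
  rw [arcIntegral_const_mul, ← e2] at up lo
  exact abs_le.2 ⟨le_of_mul_le_mul_right lo hL, le_of_mul_le_mul_right up hL⟩

end ArcIntegral

/-- `κ j` is the `j`-th arclength derivative of `κ 0` for a family of closed curves of speed `v`. -/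
structure ArcJet {ι : Type*} (v : ι → ℝ → ℝ) (κ : ℕ → ι → ℝ → ℝ) : Prop where
  speed : ∀ i, SmoothPeriodic (v i)
  pos : ∀ i u, 0 < v i u
  smooth : ∀ j i, SmoothPeriodic (κ j i)
  succ : ∀ j i, κ (j + 1) i = aderiv (v i) (κ j i)

/-- Polynomials in `κ 0, …, κ n` whose monomials carry at most `w` derivatives. -/
inductive DiffPoly {ι : Type*} (κ : ℕ → ι → ℝ → ℝ) (n : ℕ) : ℕ → (ι → ℝ → ℝ) → Prop
  | const (w : ℕ) (c : ℝ) : DiffPoly κ n w fun _ _ => c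
  | gen {w : ℕ} (j : ℕ) (hn : j ≤ n) (hw : j ≤ w) : DiffPoly κ n w (κ j)
  | add {w : ℕ} {f g : ι → ℝ → ℝ} : DiffPoly κ n w f → DiffPoly κ n w g →
      DiffPoly κ n w fun i u => f i u + g i u
  | mul {w₁ w₂ w : ℕ} {f g : ι → ℝ → ℝ} (h : w₁ + w₂ ≤ w) : DiffPoly κ n w₁ f →
      DiffPoly κ n w₂ g → DiffPoly κ n w fun i u => f i u * g i u

namespace DiffPoly

variable {ι : Type*} {v : ι → ℝ → ℝ} {κ : ℕ → ι → ℝ → ℝ} {f g : ι → ℝ → ℝ} {n w : ℕ}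

theorem mono (hf : DiffPoly κ n w f) {n' w' : ℕ} (hn : n ≤ n') (hw : w ≤ w') :
    DiffPoly κ n' w' f := by
  induction hf generalizing w' with
  | const w c => exact const _ c
  | gen j h1 h2 => exact gen j (h1.trans hn) (h2.trans hw)
  | add _ _ ihf ihg => exact (ihf hw).add (ihg hw)
  | mul h _ _ ihf ihg => exact mul (h.trans hw) (ihf le_rfl) (ihg le_rfl)

theorem smooth (hJ : ArcJet v κ) (hf : DiffPoly κ n w f) (i : ι) : SmoothPeriodic (f i) := by
  induction hf with
  | const w c => exact .const c
  | gen j _ _ => exact hJ.smooth j i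
  | add _ _ ihf ihg => exact ihf.add ihg
  | mul _ _ _ ihf ihg => exact ihf.mul ihg

theorem aderiv (hJ : ArcJet v κ) (hf : DiffPoly κ n w f) :
    DiffPoly κ (n + 1) (w + 1) fun i => aderiv (v i) (f i) := by
  induction hf with
  | const w c =>
    simp only [aderiv_const]
    exact const _ 0
  | gen j h1 h2 =>
    have : (fun i => _root_.aderiv (v i) (κ j i)) = κ (j + 1) := funext fun i => (hJ.succ j i).symm
    rw [this]
    exact gen _ (Nat.succ_le_succ h1) (Nat.succ_le_succ h2)
  | add hf hg ihf ihg =>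
    simp only [aderiv_add (hf.smooth hJ _) (hg.smooth hJ _)]
    exact ihf.add ihg
  | mul h hf hg ihf ihg =>
    simp only [aderiv_mul (hf.smooth hJ _) (hg.smooth hJ _)]
    exact (mul (by omega) ihf (hg.mono (Nat.le_succ _) le_rfl)).add
      (mul (by omega) (hf.mono (Nat.le_succ _) le_rfl) ihg)

/-- Scale-invariant bounds for the generators up to order `m` propagate to polynomials in them. -/
theorem exists_bound (hJ : ArcJet v κ) {y : ι → ℝ} (hy : ∀ i, 1 ≤ y i) {m : ℕ} {Λ : ℝ}
    (hL : ∀ i, √(arcIntegral (v i) fun _ => 1) ≤ Λ)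
    (hgen : ∀ j ≤ m, ∃ C : ℝ, 0 ≤ C ∧ ∀ i,
      (∀ u ∈ Set.Icc (0 : ℝ) 1, |κ j i u| ≤ C * y i ^ j) ∧
        arcNorm (v i) (κ j i) ≤ C * y i ^ (j - 1))
    (hf : DiffPoly κ n w f) (hn : n ≤ m) :
    ∃ C : ℝ, 0 ≤ C ∧ ∀ i, (∀ u ∈ Set.Icc (0 : ℝ) 1, |f i u| ≤ C * y i ^ w) ∧
      arcNorm (v i) (f i) ≤ C * y i ^ (w - 1) := by
  have hy0 : ∀ i, 0 ≤ y i := fun i => zero_le_one.trans (hy i)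
  induction hf with
  | const w c =>
    refine ⟨|c| * max 1 Λ, by positivity, fun i => ⟨fun u _ => ?_, ?_⟩⟩
    · have h1 : 1 ≤ max 1 Λ * y i ^ w :=
        one_le_mul_of_one_le_of_one_le (le_max_left _ _) (one_le_pow₀ (hy i) (n := w))
      calc |c| ≤ |c| * (max 1 Λ * y i ^ w) := le_mul_of_one_le_right (abs_nonneg _) h1
        _ = _ := by ring
    · rw [arcNorm_const, mul_assoc]
      refine mul_le_mul_of_nonneg_left ?_ (abs_nonneg _)
      exact ((hL i).trans (le_max_right _ _)).trans
        (le_mul_of_one_le_right (by positivity) (one_le_pow₀ (hy i)))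
  | gen j h1 h2 =>
    obtain ⟨C, hC, h⟩ := hgen j (h1.trans hn)
    refine ⟨C, hC, fun i => ⟨fun u hu => ((h i).1 u hu).trans ?_, (h i).2.trans ?_⟩⟩
    · exact mul_le_mul_of_nonneg_left (pow_le_pow_right₀ (hy i) h2) hC
    · exact mul_le_mul_of_nonneg_left (pow_le_pow_right₀ (hy i) (by omega)) hC
  | add hf hg ihf ihg =>
    obtain ⟨C, hC, h⟩ := ihf
    obtain ⟨C', hC', h'⟩ := ihg
    refine ⟨C + C', add_nonneg hC hC', fun i => ⟨fun u hu => ?_, ?_⟩⟩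
    · rw [add_mul]
      exact (abs_add_le _ _).trans (add_le_add ((h i).1 u hu) ((h' i).1 u hu))
    · rw [add_mul]
      exact (arcNorm_add_le (hJ.speed i).continuous (hJ.pos i) (hf.smooth hJ i).continuous
        (hg.smooth hJ i).continuous).trans (add_le_add (h i).2 (h' i).2)
  | @mul w₁ w₂ w f g hw hf hg ihf ihg =>
    obtain ⟨C, hC, h⟩ := ihf
    obtain ⟨C', hC', h'⟩ := ihg
    refine ⟨C * C', mul_nonneg hC hC', fun i => ⟨fun u hu => ?_, ?_⟩⟩
    · rw [abs_mul]
      calc |f i u| * |g i u| ≤ (C * y i ^ w₁) * (C' * y i ^ w₂) :=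
            mul_le_mul ((h i).1 u hu) ((h' i).1 u hu) (abs_nonneg _)
              (mul_nonneg hC (pow_nonneg (hy0 i) _))
        _ = C * C' * y i ^ (w₁ + w₂) := by ring
        _ ≤ _ := mul_le_mul_of_nonneg_left (pow_le_pow_right₀ (hy i) hw) (mul_nonneg hC hC')
    · have hfc := (hf.smooth hJ i).continuous
      have hgc := (hg.smooth hJ i).continuous
      rcases Nat.eq_zero_or_pos w₂ with h0 | h0
      · subst h0
        calc arcNorm (v i) (fun u => f i u * g i u)
            = arcNorm (v i) (fun u => g i u * f i u) := by simp only [mul_comm]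
          _ ≤ (C' * y i ^ 0) * arcNorm (v i) (f i) :=
            arcNorm_mul_le (hJ.speed i).continuous (hJ.pos i) hgc hfc
              (mul_nonneg hC' (pow_nonneg (hy0 i) _)) (h' i).1
          _ ≤ (C' * y i ^ 0) * (C * y i ^ (w₁ - 1)) :=
            mul_le_mul_of_nonneg_left (h i).2 (mul_nonneg hC' (pow_nonneg (hy0 i) _))
          _ = C * C' * y i ^ (w₁ - 1) := by ring
          _ ≤ _ := mul_le_mul_of_nonneg_left (pow_le_pow_right₀ (hy i) (by omega))
            (mul_nonneg hC hC')
      · calc arcNorm (v i) (fun u => f i u * g i u)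
            ≤ (C * y i ^ w₁) * arcNorm (v i) (g i) :=
            arcNorm_mul_le (hJ.speed i).continuous (hJ.pos i) hfc hgc
              (mul_nonneg hC (pow_nonneg (hy0 i) _)) (h i).1
          _ ≤ (C * y i ^ w₁) * (C' * y i ^ (w₂ - 1)) :=
            mul_le_mul_of_nonneg_left (h' i).2 (mul_nonneg hC (pow_nonneg (hy0 i) _))
          _ = C * C' * y i ^ (w₁ + (w₂ - 1)) := by ring
          _ ≤ _ := mul_le_mul_of_nonneg_left (pow_le_pow_right₀ (hy i) (by omega))
            (mul_nonneg hC hC')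

end DiffPoly

/-- A nonnegative log-convex sequence is bounded by one between indices where it is. -/
theorem le_one_of_logConvex {b : ℕ → ℝ} (h0 : ∀ j, 0 ≤ b j)
    (hconv : ∀ j, b (j + 1) ^ 2 ≤ b j * b (j + 2)) {n : ℕ} (hb0 : b 0 ≤ 1) (hbn : b n ≤ 1)
    {j : ℕ} (hj : j ≤ n) : b j ≤ 1 := by
  by_contra hlt
  rw [not_le] at hlt
  classical
  have hex : ∃ j, 1 < b j := ⟨j, hlt⟩
  obtain ⟨m, hm⟩ : ∃ m, Nat.find hex = m + 1 :=
    Nat.exists_eq_succ_of_ne_zero fun h => absurd (h ▸ Nat.find_spec hex) hb0.not_gt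
  have hm1 : 1 < b (m + 1) := hm ▸ Nat.find_spec hex
  have hm0 : b m ≤ 1 := not_lt.1 (Nat.find_min hex (by omega))
  have hmj : m + 1 ≤ j := hm ▸ Nat.find_min' hex hlt
  have key : ∀ i, 1 < b (m + 1 + i) ∧ b (m + i) ≤ b (m + 1 + i) := by
    intro i
    induction i with
    | zero => exact ⟨hm1, hm0.trans hm1.le⟩
    | succ i ih =>
      obtain ⟨h1, h2⟩ := ih
      have h3 := hconv (m + i)
      rw [show m + i + 1 = m + 1 + i by ring, show m + i + 2 = m + 1 + (i + 1) by ring] at h3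
      have h4 : b (m + 1 + i) ≤ b (m + 1 + (i + 1)) := by
        have := h0 (m + 1 + (i + 1))
        nlinarith
      exact ⟨h1.trans_le h4, by rwa [show m + (i + 1) = m + 1 + i by ring]⟩
  have := (key (n - (m + 1))).1
  rw [show m + 1 + (n - (m + 1)) = n by omega] at this
  exact absurd this hbn.not_gt

namespace ArcJet

variable {ι : Type*} {v : ι → ℝ → ℝ} {κ : ℕ → ι → ℝ → ℝ}

theorem integral_mul_succ (hJ : ArcJet v κ) {f : ι → ℝ → ℝ} (hf : ∀ i, SmoothPeriodic (f i))
    (j : ℕ) (i : ι) :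
    arcIntegral (v i) (fun u => κ j i u * aderiv (v i) (f i) u) =
      -arcIntegral (v i) (fun u => κ (j + 1) i u * f i u) := by
  have := arcIntegral_aderiv_mul (hJ.speed i) (hJ.pos i) (hJ.smooth j i) (hf i)
  rw [hJ.succ, this, neg_neg]

theorem integral_succ (hJ : ArcJet v κ) (j : ℕ) (i : ι) : arcIntegral (v i) (κ (j + 1) i) = 0 := by
  rw [hJ.succ]
  exact arcIntegral_aderiv (hJ.pos i) (hJ.smooth j i)

theorem abs_le_arcNorm_succ (hJ : ArcJet v κ) (j : ℕ) (i : ι) {u : ℝ}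
    (hu : u ∈ Set.Icc (0 : ℝ) 1) :
    |κ (j + 1) i u| ≤ √(arcIntegral (v i) fun _ => 1) * arcNorm (v i) (κ (j + 2) i) := by
  have := abs_sub_mean_le (hJ.speed i) (hJ.pos i) (hJ.smooth (j + 1) i) (c := 0)
    (by rw [hJ.integral_succ, zero_mul]) hu
  rwa [sub_zero, ← hJ.succ] at this

/-- The interpolation scale `(1 + ‖κ 8‖)^(1/7)`. -/
noncomputable def scale (v : ι → ℝ → ℝ) (κ : ℕ → ι → ℝ → ℝ) (i : ι) : ℝ :=
  (1 + arcNorm (v i) (κ 8 i)) ^ (1 / 7 : ℝ)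

theorem one_le_scale (i : ι) : 1 ≤ scale v κ i :=
  Real.one_le_rpow (le_add_of_nonneg_right arcNorm_nonneg) (by norm_num)

theorem scale_pow (i : ι) : scale v κ i ^ 7 = 1 + arcNorm (v i) (κ 8 i) := by
  have h : (0 : ℝ) ≤ 1 + arcNorm (v i) (κ 8 i) := add_nonneg zero_le_one arcNorm_nonneg
  rw [scale, ← Real.rpow_natCast, ← Real.rpow_mul h]
  norm_num

theorem arcNorm_succ_le (hJ : ArcJet v κ) {M : ℝ} (hM1 : 1 ≤ M)
    (hE : ∀ i, arcNorm (v i) (κ 1 i) ≤ M) (i : ι) {j : ℕ} (hj : j ≤ 7) :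
    arcNorm (v i) (κ (j + 1) i) ≤ M * scale v κ i ^ j := by
  have hy := one_le_scale (v := v) (κ := κ) i
  set y := scale v κ i with hydef
  have hy0 : 0 < y := zero_lt_one.trans_le hy
  have hM : 0 < M := zero_lt_one.trans_le hM1
  have h := le_one_of_logConvex (b := fun j => arcNorm (v i) (κ (j + 1) i) / (M * y ^ j))
    (n := 7) (fun j => div_nonneg arcNorm_nonneg (by positivity)) (fun j => ?_) ?_ ?_ hj
  · exact (div_le_one (by positivity)).1 h
  · have h1 := sq_arcNorm_aderiv_le (hJ.speed i) (hJ.pos i) (hJ.smooth (j + 1) i)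
    rw [← hJ.succ, ← hJ.succ] at h1
    have h2 : ∀ a b : ℝ, a / (M * y ^ j) * (b / (M * y ^ (j + 2))) =
        (a * b) / (M * y ^ (j + 1)) ^ 2 := by
      intro a b
      field_simp
      ring
    rw [h2, div_pow]
    exact div_le_div_of_nonneg_right h1 (by positivity)
  · simpa using (div_le_one hM).2 (hE i)
  · refine (div_le_one (by positivity)).2 ?_
    rw [hydef, scale_pow]
    have : 0 ≤ arcNorm (v i) (κ 8 i) := arcNorm_nonneg
    nlinarith

theorem exists_gen_bound (hJ : ArcJet v κ) {M : ℝ} (hM1 : 1 ≤ M)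
    (hL : ∀ i, √(arcIntegral (v i) fun _ => 1) ≤ M)
    (hE : ∀ i, arcNorm (v i) (κ 1 i) ≤ M)
    (hk : ∀ i, ∀ u ∈ Set.Icc (0 : ℝ) 1, |κ 0 i u| ≤ M) {j : ℕ} (hj : j ≤ 7) :
    ∃ C : ℝ, 0 ≤ C ∧ ∀ i, (∀ u ∈ Set.Icc (0 : ℝ) 1, |κ j i u| ≤ C * scale v κ i ^ j) ∧
      arcNorm (v i) (κ j i) ≤ C * scale v κ i ^ (j - 1) := by
  have hM : 0 ≤ M := zero_le_one.trans hM1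
  refine ⟨M * M, mul_nonneg hM hM, fun i => ?_⟩
  have hy := one_le_scale (v := v) (κ := κ) i
  cases j with
  | zero =>
    simp only [pow_zero, mul_one, Nat.zero_sub]
    refine ⟨fun u hu => (hk i u hu).trans (le_mul_of_one_le_left hM hM1), ?_⟩
    have h := arcNorm_mul_le (hJ.speed i).continuous (hJ.pos i) (hJ.smooth 0 i).continuous
      (continuous_const (y := (1 : ℝ))) hM (hk i)
    simp only [mul_one, arcNorm_const, abs_one, one_mul] at h
    exact h.trans (mul_le_mul_of_nonneg_left (hL i) hM)
  | succ j =>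
    refine ⟨fun u hu => (hJ.abs_le_arcNorm_succ j i hu).trans ?_, ?_⟩
    · rw [mul_assoc]
      exact mul_le_mul (hL i) (hJ.arcNorm_succ_le hM1 hE i hj) arcNorm_nonneg hM
    · refine (hJ.arcNorm_succ_le hM1 hE i (by omega)).trans ?_
      rw [Nat.add_sub_cancel]
      exact mul_le_mul_of_nonneg_right (le_mul_of_one_le_left hM hM1)
        (pow_nonneg (zero_le_one.trans hy) _)

end ArcJet

section IdealFlow

variable {ι : Type*} {v : ι → ℝ → ℝ} {κ : ℕ → ι → ℝ → ℝ}

/-- The nonlinear part of the normal speed of the ideal flow. -/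
noncomputable def idealNonlin (κ : ℕ → ι → ℝ → ℝ) (i : ι) (u : ℝ) : ℝ :=
  κ 0 i u * κ 0 i u * κ 2 i u + -(1 / 2) * (κ 0 i u * (κ 1 i u * κ 1 i u))

/-- The normal speed of the ideal flow. -/
noncomputable def idealSpeed (κ : ℕ → ι → ℝ → ℝ) (i : ι) (u : ℝ) : ℝ :=
  κ 4 i u + idealNonlin κ i u

/-- The time derivative of `κ j` along the ideal flow is `κ (j + 6) + idealRem v κ j`. -/
noncomputable def idealRem (v : ι → ℝ → ℝ) (κ : ℕ → ι → ℝ → ℝ) : ℕ → ι → ℝ → ℝ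
  | 0 => fun i u => aderiv (v i) (aderiv (v i) (idealNonlin κ i)) u +
      κ 0 i u * κ 0 i u * idealSpeed κ i u
  | j + 1 => fun i u => aderiv (v i) (idealRem v κ j i) u +
      κ 0 i u * idealSpeed κ i u * κ (j + 1) i u

theorem diffPoly_idealNonlin : DiffPoly κ 2 2 (idealNonlin κ) := by
  have g0 : DiffPoly κ 2 0 (κ 0) := .gen 0 (by simp) le_rfl
  have g1 : DiffPoly κ 2 1 (κ 1) := .gen 1 (by simp) le_rfl
  have g2 : DiffPoly κ 2 2 (κ 2) := .gen 2 (by simp) le_rfl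
  exact (DiffPoly.mul (le_refl 2) (.mul (le_refl 0) g0 g0) g2).add
    (.mul (le_refl (0 + 2)) (.const _ (-(1 / 2))) (.mul (le_refl (0 + 2)) g0 (.mul le_rfl g1 g1)))

theorem diffPoly_idealSpeed : DiffPoly κ 4 4 (idealSpeed κ) :=
  DiffPoly.add (.gen 4 le_rfl le_rfl) (diffPoly_idealNonlin.mono (by simp) (by simp))

theorem diffPoly_idealRem (hJ : ArcJet v κ) (j : ℕ) :
    DiffPoly κ (j + 4) (j + 4) (idealRem v κ j) := by
  induction j with
  | zero =>
    have g0 : DiffPoly κ 4 0 (κ 0) := .gen 0 (by simp) le_rfl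
    exact ((diffPoly_idealNonlin.aderiv hJ).aderiv hJ).add
      (.mul (le_refl (0 + 4)) (.mul (le_refl 0) g0 g0) diffPoly_idealSpeed)
  | succ j ih =>
    have g0 : DiffPoly κ (j + 1 + 4) 0 (κ 0) := .gen 0 (by simp) le_rfl
    have h := ih.aderiv hJ
    rw [show j + 4 + 1 = j + 1 + 4 by ring] at h
    exact h.add (.mul (w₁ := 4) (w₂ := j + 1) (by omega)
      (.mul (le_refl (0 + 4)) g0 (diffPoly_idealSpeed.mono (by omega) le_rfl))
      (.gen (j + 1) (by omega) le_rfl))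

/-- Along the ideal flow the time derivative of `∫ κ₅² ds` is bounded above in terms of the length,
the energy and the maximal curvature. -/
theorem exists_energy_deriv_le (hJ : ArcJet v κ) {M : ℝ} (hM1 : 1 ≤ M)
    (hL : ∀ i, √(arcIntegral (v i) fun _ => 1) ≤ M)
    (hE : ∀ i, arcNorm (v i) (κ 1 i) ≤ M)
    (hk : ∀ i, ∀ u ∈ Set.Icc (0 : ℝ) 1, |κ 0 i u| ≤ M) :
    ∃ C : ℝ, ∀ i, arcIntegral (v i) (fun u => 2 * (κ 5 i u * (κ 11 i u + idealRem v κ 5 i u)) +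
      -1 * (κ 5 i u * (κ 0 i u * idealSpeed κ i u * κ 5 i u))) ≤ C := by
  have hy := ArcJet.one_le_scale (v := v) (κ := κ)
  have hbd : ∀ (j w : ℕ) (f : ι → ℝ → ℝ), j ≤ 7 → DiffPoly κ 7 w f → j + (w - 1) = 12 →
      ∃ C : ℝ, ∀ i, |arcIntegral (v i) fun u => κ (j + 1) i u * f i u| ≤
        C * ArcJet.scale v κ i ^ 12 := by
    intro j w f hj hf hw
    obtain ⟨C, hC, h⟩ := hf.exists_bound hJ hy hL
      (fun j hj => hJ.exists_gen_bound hM1 hL hE hk hj) le_rfl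
    refine ⟨M * C, fun i => (abs_arcIntegral_mul_le (hJ.speed i).continuous (hJ.pos i)
      (hJ.smooth _ i).continuous (hf.smooth hJ i).continuous).trans ?_⟩
    have hy0 : 0 ≤ ArcJet.scale v κ i := zero_le_one.trans (hy i)
    calc arcNorm (v i) (κ (j + 1) i) * arcNorm (v i) (f i)
        ≤ (M * ArcJet.scale v κ i ^ j) * (C * ArcJet.scale v κ i ^ (w - 1)) :=
          mul_le_mul (hJ.arcNorm_succ_le hM1 hE i hj) (h i).2 arcNorm_nonneg (by positivity)
      _ = M * C * ArcJet.scale v κ i ^ (j + (w - 1)) := by ring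
      _ = _ := by rw [hw]
  have hR : ∀ j ≤ 7, DiffPoly κ 7 (j + 4) fun i u => κ 0 i u * idealSpeed κ i u * κ j i u :=
    fun j hj => .mul (w₁ := 4) (w₂ := j) (by omega)
      (.mul (le_refl (0 + 4)) (.gen 0 (by simp) le_rfl)
        (diffPoly_idealSpeed.mono (by simp) le_rfl)) (.gen j hj le_rfl)
  obtain ⟨C₂, h₂⟩ := hbd 7 6 _ le_rfl ((diffPoly_idealRem hJ 2).mono (by simp) (by simp)) rfl
  obtain ⟨C₃, h₃⟩ := hbd 6 7 _ (by simp) (hR 3 (by simp)) rfl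
  obtain ⟨C₄, h₄⟩ := hbd 5 8 _ (by simp) (hR 4 (by simp)) rfl
  obtain ⟨C₅, h₅⟩ := hbd 4 9 _ (by simp) (hR 5 (by simp)) rfl
  set C := 2 * C₂ + 2 * C₃ + 2 * C₄ + 3 * C₅ with hC
  refine ⟨2 + |C| * |C| ^ 6, fun i => ?_⟩
  have hRs : ∀ j, SmoothPeriodic (idealRem v κ j i) := fun j =>
    (diffPoly_idealRem hJ j).smooth hJ i
  have hQs : ∀ j, SmoothPeriodic fun u => κ 0 i u * idealSpeed κ i u * κ j i u := fun j =>
    ((hJ.smooth 0 i).mul (diffPoly_idealSpeed.smooth hJ i)).mul (hJ.smooth j i)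
  have lead : arcIntegral (v i) (fun u => κ 5 i u * κ 11 i u) =
      -arcNorm (v i) (κ 8 i) ^ 2 := by
    have e : ∀ j l, arcIntegral (v i) (fun u => κ j i u * κ (l + 1) i u) =
        -arcIntegral (v i) (fun u => κ (j + 1) i u * κ l i u) := fun j l => by
      rw [hJ.succ l]
      exact hJ.integral_mul_succ (hJ.smooth l) j i
    rw [e 5 10, e 6 9, e 7 8, sq_arcNorm (hJ.pos i)]
    simp only [sq, neg_neg]
  have step : ∀ j l, arcIntegral (v i) (fun u => κ j i u * idealRem v κ (l + 1) i u) =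
      -arcIntegral (v i) (fun u => κ (j + 1) i u * idealRem v κ l i u) +
        arcIntegral (v i) (fun u => κ j i u * (κ 0 i u * idealSpeed κ i u * κ (l + 1) i u)) := by
    intro j l
    rw [← hJ.integral_mul_succ (fun i => (diffPoly_idealRem hJ l).smooth hJ i),
      ← arcIntegral_add (hJ.speed i).continuous
        ((hJ.smooth j i).mul ((hJ.speed i).aderiv (hJ.pos i) (hRs l))).continuous
        ((hJ.smooth j i).mul (hQs (l + 1))).continuous]
    congr 1
    funext u
    simp only [idealRem]
    ring
  have split : arcIntegral (v i) (fun u => 2 * (κ 5 i u * (κ 11 i u + idealRem v κ 5 i u)) +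
      -1 * (κ 5 i u * (κ 0 i u * idealSpeed κ i u * κ 5 i u))) =
      2 * (arcIntegral (v i) (fun u => κ 5 i u * κ 11 i u) +
        arcIntegral (v i) (fun u => κ 5 i u * idealRem v κ 5 i u)) +
      -1 * arcIntegral (v i) (fun u => κ 5 i u * (κ 0 i u * idealSpeed κ i u * κ 5 i u)) := by
    have c5 := (hJ.smooth 5 i).continuous
    have c11 := (hJ.smooth 11 i).continuous
    have cR := (hRs 5).continuous
    rw [arcIntegral_add (hJ.speed i).continuous (by fun_prop)
      ((SmoothPeriodic.const (-1)).mul ((hJ.smooth 5 i).mul (hQs 5))).continuous, arcIntegral_const_mul, arcIntegral_const_mul,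
      ← arcIntegral_add (hJ.speed i).continuous (by fun_prop) (by fun_prop)]
    simp only [mul_add]
  rw [split, lead, step 5 4, step 6 3, step 7 2]
  have hy12 : 1 ≤ ArcJet.scale v κ i ^ 12 := one_le_pow₀ (hy i)
  have b₂ := abs_le.1 (h₂ i)
  have b₃ := abs_le.1 (h₃ i)
  have b₄ := abs_le.1 (h₄ i)
  have b₅ := abs_le.1 (h₅ i)
  have hfin : -2 * arcNorm (v i) (κ 8 i) ^ 2 + C * ArcJet.scale v κ i ^ 12 ≤ 2 + |C| * |C| ^ 6 := by
    have hs := ArcJet.scale_pow (v := v) (κ := κ) i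
    have hN : arcNorm (v i) (κ 8 i) = ArcJet.scale v κ i ^ 7 - 1 := by linarith
    rw [hN]
    have hy1 := hy i
    generalize ArcJet.scale v κ i = y at hy1
    have h1 : -2 * (y ^ 7 - 1) ^ 2 ≤ 2 - (y ^ 7) ^ 2 := by nlinarith [sq_nonneg (y ^ 7 - 2)]
    have h2 : C * y ^ 12 ≤ |C| * y ^ 12 :=
      mul_le_mul_of_nonneg_right (le_abs_self C) (by positivity)
    have h3 : |C| * y ^ 12 - (y ^ 7) ^ 2 ≤ |C| * |C| ^ 6 := by
      rcases le_total (y ^ 2) |C| with h | h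
      · have : (y ^ 2) ^ 6 ≤ |C| ^ 6 := pow_le_pow_left₀ (by positivity) h 6
        have : |C| * (y ^ 2) ^ 6 ≤ |C| * |C| ^ 6 := mul_le_mul_of_nonneg_left this (abs_nonneg _)
        have h4 : 0 ≤ (y ^ 7) ^ 2 := by positivity
        ring_nf at this h4 ⊢
        linarith
      · have : |C| * y ^ 12 ≤ y ^ 2 * y ^ 12 := mul_le_mul_of_nonneg_right h (by positivity)
        have h4 : 0 ≤ |C| * |C| ^ 6 := by positivity
        have h5 : y ^ 2 * y ^ 12 = (y ^ 7) ^ 2 := by ring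
        linarith
    linarith
  have hCy : C * ArcJet.scale v κ i ^ 12 = 2 * (C₂ * ArcJet.scale v κ i ^ 12) + 2 * (C₃ * ArcJet.scale v κ i ^ 12) +
      2 * (C₄ * ArcJet.scale v κ i ^ 12) + 3 * (C₅ * ArcJet.scale v κ i ^ 12) := by rw [hC]; ring
  norm_num only at b₂ b₃ b₄ b₅ ⊢
  linarith [b₂.1, b₂.2, b₃.1, b₃.2, b₄.1, b₄.2, b₅.1, b₅.2]

end IdealFlow

section FirstVariation

variable {ι : Type*} {v : ι → ℝ → ℝ} {κ : ℕ → ι → ℝ → ℝ}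

theorem idealRem_zero_eq (hJ : ArcJet v κ) (i : ι) :
    (fun u => κ 6 i u + idealRem v κ 0 i u) = fun u =>
      aderiv (v i) (aderiv (v i) (idealSpeed κ i)) u + κ 0 i u * κ 0 i u * idealSpeed κ i u := by
  have hG := diffPoly_idealNonlin.smooth hJ i
  have h : aderiv (v i) (aderiv (v i) (idealSpeed κ i)) =
      fun u => κ 6 i u + aderiv (v i) (aderiv (v i) (idealNonlin κ i)) u := by
    change aderiv (v i) (aderiv (v i) (fun u => κ 4 i u + idealNonlin κ i u)) = _
    rw [aderiv_add (hJ.smooth 4 i) hG, ← hJ.succ, aderiv_add (hJ.smooth 5 i)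
      ((hJ.speed i).aderiv (hJ.pos i) hG), ← hJ.succ]
  rw [h]
  funext u
  simp only [idealRem]
  ring

theorem idealRem_one_eq (hJ : ArcJet v κ) (i : ι) :
    (fun u => κ 7 i u + idealRem v κ 1 i u) = fun u =>
      aderiv (v i) (aderiv (v i) (aderiv (v i) (idealSpeed κ i))) u +
        aderiv (v i) (fun u => κ 0 i u * κ 0 i u * idealSpeed κ i u) u +
        κ 0 i u * idealSpeed κ i u * κ 1 i u := by
  have hF := diffPoly_idealSpeed.smooth hJ i
  have h := congrArg (aderiv (v i)) (idealRem_zero_eq hJ i)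
  rw [aderiv_add (hJ.smooth 6 i) ((diffPoly_idealRem hJ 0).smooth hJ i), ← hJ.succ, aderiv_add
    ((hJ.speed i).aderiv (hJ.pos i) ((hJ.speed i).aderiv (hJ.pos i) hF))
    (((hJ.smooth 0 i).mul (hJ.smooth 0 i)).mul hF)] at h
  funext u
  rw [← congrFun h u]
  simp only [idealRem]
  ring

theorem integral_curvature_deriv (hJ : ArcJet v κ) (i : ι) :
    arcIntegral (v i) (fun u => κ 6 i u + idealRem v κ 0 i u +
      -1 * (κ 0 i u * (κ 0 i u * idealSpeed κ i u))) = 0 := by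
  have hF := diffPoly_idealSpeed.smooth hJ i
  have h : (fun u => κ 6 i u + idealRem v κ 0 i u +
      -1 * (κ 0 i u * (κ 0 i u * idealSpeed κ i u))) =
      aderiv (v i) (aderiv (v i) (idealSpeed κ i)) := by
    funext u
    rw [congrFun (idealRem_zero_eq hJ i) u]
    ring
  rw [h, arcIntegral_aderiv (hJ.pos i) ((hJ.speed i).aderiv (hJ.pos i) hF)]

theorem integral_energy_deriv (hJ : ArcJet v κ) (i : ι) :
    arcIntegral (v i) (fun u => 2 * (κ 1 i u * (κ 7 i u + idealRem v κ 1 i u)) +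
      -1 * (κ 1 i u ^ 2 * (κ 0 i u * idealSpeed κ i u))) =
      -2 * arcIntegral (v i) (fun u => idealSpeed κ i u ^ 2) := by
  have hv := hJ.speed i
  have hp := hJ.pos i
  have hF := diffPoly_idealSpeed.smooth hJ i
  have hF1 := hv.aderiv hp hF
  have hF2 := hv.aderiv hp hF1
  have hF3 := hv.aderiv hp hF2
  have s0 := hJ.smooth 0 i
  have s1 := hJ.smooth 1 i
  have s2 := hJ.smooth 2 i
  have s4 := hJ.smooth 4 i
  have hQ := (s0.mul s0).mul hF
  have e1 : arcIntegral (v i) (fun u => κ 1 i u *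
      aderiv (v i) (aderiv (v i) (aderiv (v i) (idealSpeed κ i))) u) =
      -arcIntegral (v i) (fun u => κ 4 i u * idealSpeed κ i u) := by
    have p : ∀ j (f : ℝ → ℝ), SmoothPeriodic f →
        arcIntegral (v i) (fun u => κ j i u * aderiv (v i) f u) =
          -arcIntegral (v i) (fun u => κ (j + 1) i u * f u) := fun j f hf => by
      rw [hJ.succ, arcIntegral_aderiv_mul hv hp (hJ.smooth j i) hf, neg_neg]
    rw [p 1 _ hF2, p 2 _ hF1, p 3 _ hF, neg_neg]
  have e2 : arcIntegral (v i) (fun u => κ 1 i u *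
      aderiv (v i) (fun u => κ 0 i u * κ 0 i u * idealSpeed κ i u) u) =
      -arcIntegral (v i) (fun u => κ 2 i u * (κ 0 i u * κ 0 i u * idealSpeed κ i u)) := by
    rw [hJ.succ 1, arcIntegral_aderiv_mul hv hp s1 hQ, neg_neg]
  have h1 : (fun u => 2 * (κ 1 i u * (κ 7 i u + idealRem v κ 1 i u)) +
      -1 * (κ 1 i u ^ 2 * (κ 0 i u * idealSpeed κ i u))) = fun u =>
      (2 * (κ 1 i u * aderiv (v i) (aderiv (v i) (aderiv (v i) (idealSpeed κ i))) u) +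
      2 * (κ 1 i u * aderiv (v i) (fun u => κ 0 i u * κ 0 i u * idealSpeed κ i u) u)) +
      1 * (κ 1 i u * κ 1 i u * (κ 0 i u * idealSpeed κ i u)) := by
    funext u
    rw [congrFun (idealRem_one_eq hJ i) u]
    ring
  have h2 : (fun u => idealSpeed κ i u ^ 2) = fun u =>
      (1 * (κ 4 i u * idealSpeed κ i u) +
        1 * (κ 2 i u * (κ 0 i u * κ 0 i u * idealSpeed κ i u))) +
      -(1 / 2) * (κ 1 i u * κ 1 i u * (κ 0 i u * idealSpeed κ i u)) := by
    funext u
    simp only [idealSpeed, idealNonlin]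
    ring
  have c (a : ℝ) {f : ℝ → ℝ} (hf : SmoothPeriodic f) : Continuous fun u => a * f u :=
    continuous_const.mul hf.continuous
  have hS3 := (s1.mul s1).mul (s0.mul hF)
  rw [h1, h2, arcIntegral_add hv.continuous
      (((SmoothPeriodic.const 2).mul (s1.mul hF3)).add
        ((SmoothPeriodic.const 2).mul (s1.mul (hv.aderiv hp hQ)))).continuous (c 1 hS3),
    arcIntegral_add hv.continuous (c 2 (s1.mul hF3)) (c 2 (s1.mul (hv.aderiv hp hQ))),
    arcIntegral_add hv.continuous (((SmoothPeriodic.const 1).mul (s4.mul hF)).add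
      ((SmoothPeriodic.const 1).mul (s2.mul hQ))).continuous (c (-(1 / 2)) hS3),
    arcIntegral_add hv.continuous (c 1 (s4.mul hF)) (c 1 (s2.mul hQ))]
  simp only [arcIntegral_const_mul]
  rw [e1, e2]
  ring

theorem integral_idealSpeed (hJ : ArcJet v κ) (i : ι) :
    arcIntegral (v i) (idealSpeed κ i) =
      -(5 / 2) * arcIntegral (v i) (fun u => κ 0 i u * κ 1 i u ^ 2) := by
  have hv := hJ.speed i
  have s0 := hJ.smooth 0 i
  have s1 := hJ.smooth 1 i
  have s2 := hJ.smooth 2 i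
  have s4 := hJ.smooth 4 i
  have p : arcIntegral (v i) (fun u => κ 0 i u * κ 0 i u * κ 2 i u) =
      -arcIntegral (v i) (fun u => 2 * (κ 0 i u * κ 1 i u ^ 2)) := by
    have h := arcIntegral_aderiv_mul hv (hJ.pos i) (s0.mul s0) s1
    rw [aderiv_mul s0 s0, ← hJ.succ, ← hJ.succ] at h
    rw [← neg_eq_iff_eq_neg, ← h]
    congr 1
    funext u
    ring
  have h : idealSpeed κ i = fun u => (κ 4 i u + κ 0 i u * κ 0 i u * κ 2 i u) +
      -(1 / 2) * (κ 0 i u * κ 1 i u ^ 2) := by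
    funext u
    simp only [idealSpeed, idealNonlin]
    ring
  have c (a : ℝ) {f : ℝ → ℝ} (hf : SmoothPeriodic f) : Continuous fun u => a * f u :=
    continuous_const.mul hf.continuous
  rw [h, arcIntegral_add hv.continuous (s4.add ((s0.mul s0).mul s2)).continuous
    (c _ (s0.mul (s1.pow 2))), arcIntegral_add hv.continuous s4.continuous
    ((s0.mul s0).mul s2).continuous, hJ.integral_succ, p, arcIntegral_const_mul,
    arcIntegral_const_mul]
  ring

/-- Two-sided control of the first variation of length along the ideal flow, where `c` is the mean
curvature value, `e` the energy and `q` the dissipation. -/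
theorem length_deriv_bounds (hJ : ArcJet v κ) (i : ι) {c L e q : ℝ}
    (hL : L = arcIntegral (v i) fun _ => 1) (he : e = arcIntegral (v i) fun u => κ 1 i u ^ 2)
    (hq : q = arcIntegral (v i) fun u => idealSpeed κ i u ^ 2)
    (hc : arcIntegral (v i) (κ 0 i) = c * L) :
    -(L * ((e + q) / 2 + 5 / 8 * e ^ 2)) ≤
        -arcIntegral (v i) (fun u => κ 0 i u * idealSpeed κ i u) ∧
      -arcIntegral (v i) (fun u => κ 0 i u * idealSpeed κ i u) ≤
        L * ((e + q) / 2 + 5 / 4 * e ^ 2) + 15 / 4 * (c ^ 2 * e) := by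
  have hv := hJ.speed i
  have hp := hJ.pos i
  have hF := diffPoly_idealSpeed.smooth hJ i
  have s0 := hJ.smooth 0 i
  have s1 := hJ.smooth 1 i
  have hφ : SmoothPeriodic fun u => κ 0 i u - c := s0.sub (.const c)
  have hLpos : 0 < L := hL ▸ arcIntegral_one_pos hv.continuous hp
  have he' : arcNorm (v i) (κ 1 i) ^ 2 = e := by rw [sq_arcNorm hp, he]
  have hq' : arcNorm (v i) (idealSpeed κ i) ^ 2 = q := by rw [sq_arcNorm hp, hq]
  have hsL : √L ^ 2 = L := Real.sq_sqrt hLpos.le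
  have hosc : ∀ u ∈ Set.Icc (0 : ℝ) 1, |κ 0 i u - c| ≤ √L * arcNorm (v i) (κ 1 i) := by
    intro u hu
    have := abs_sub_mean_le hv hp s0 (hL ▸ hc) hu
    rwa [← hL, ← hJ.succ] at this
  have hosc2 : ∀ u ∈ Set.Icc (0 : ℝ) 1, (κ 0 i u - c) ^ 2 ≤ L * e := by
    intro u hu
    have := sq_le_sq' (abs_le.1 (hosc u hu)).1 (abs_le.1 (hosc u hu)).2
    rwa [mul_pow, hsL, he'] at this
  have hφF : |arcIntegral (v i) (fun u => (κ 0 i u - c) * idealSpeed κ i u)| ≤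
      L * ((e + q) / 2) := by
    refine (abs_arcIntegral_mul_le hv.continuous hp hφ.continuous hF.continuous).trans ?_
    have h1 := arcNorm_mul_le hv.continuous hp hφ.continuous (continuous_const (y := (1 : ℝ)))
      (mul_nonneg (Real.sqrt_nonneg L) arcNorm_nonneg) hosc
    simp only [mul_one, arcNorm_const, abs_one, one_mul] at h1
    rw [← hL, mul_right_comm, ← sq, hsL] at h1
    have hN : 0 ≤ arcNorm (v i) (idealSpeed κ i) := arcNorm_nonneg
    calc arcNorm (v i) (fun u => κ 0 i u - c) * arcNorm (v i) (idealSpeed κ i)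
        ≤ (L * arcNorm (v i) (κ 1 i)) * arcNorm (v i) (idealSpeed κ i) :=
          mul_le_mul_of_nonneg_right h1 hN
      _ = L * (arcNorm (v i) (κ 1 i) * arcNorm (v i) (idealSpeed κ i)) := by ring
      _ ≤ L * ((e + q) / 2) := by
          refine mul_le_mul_of_nonneg_left ?_ hLpos.le
          rw [← he', ← hq']
          linarith [two_mul_le_add_sq (arcNorm (v i) (κ 1 i)) (arcNorm (v i) (idealSpeed κ i))]
  have c' (a : ℝ) {f : ℝ → ℝ} (hf : SmoothPeriodic f) : Continuous fun u => a * f u :=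
    continuous_const.mul hf.continuous
  have hdecomp : -arcIntegral (v i) (fun u => κ 0 i u * idealSpeed κ i u) =
      -arcIntegral (v i) (fun u => (κ 0 i u - c) * idealSpeed κ i u) +
        5 / 2 * arcIntegral (v i) (fun u => c * (κ 0 i u * κ 1 i u ^ 2)) := by
    have h : (fun u => κ 0 i u * idealSpeed κ i u) =
        fun u => (κ 0 i u - c) * idealSpeed κ i u + c * idealSpeed κ i u := by funext u; ring
    rw [h, arcIntegral_add hv.continuous (hφ.mul hF).continuous (c' c hF), arcIntegral_const_mul,
      integral_idealSpeed hJ, arcIntegral_const_mul]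
    ring
  have hlow : -(1 / 4) * (L * e) * e ≤
      arcIntegral (v i) (fun u => c * (κ 0 i u * κ 1 i u ^ 2)) := by
    nth_rewrite 2 [he]
    rw [← arcIntegral_const_mul]
    refine arcIntegral_mono hv.continuous hp (c' _ (s1.pow 2)) (c' _ (s0.mul (s1.pow 2)))
      fun u hu => ?_
    have h := mul_le_mul_of_nonneg_right (hosc2 u hu) (sq_nonneg (κ 1 i u))
    have h2 : 0 ≤ (c + (κ 0 i u - c) / 2) ^ 2 * κ 1 i u ^ 2 := by positivity
    linarith
  have hup : arcIntegral (v i) (fun u => c * (κ 0 i u * κ 1 i u ^ 2)) ≤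
      (3 / 2 * c ^ 2 + 1 / 2 * (L * e)) * e := by
    nth_rewrite 2 [he]
    rw [← arcIntegral_const_mul]
    refine arcIntegral_mono hv.continuous hp (c' _ (s0.mul (s1.pow 2))) (c' _ (s1.pow 2))
      fun u hu => ?_
    have h := mul_le_mul_of_nonneg_right (hosc2 u hu) (sq_nonneg (κ 1 i u))
    have h2 : 0 ≤ (c - (κ 0 i u - c)) ^ 2 * κ 1 i u ^ 2 := by positivity
    linarith
  rw [hdecomp]
  obtain ⟨h1, h2⟩ := abs_le.1 hφF
  constructor <;> linarith

end FirstVariation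

/-- Functions of time and space which are smooth on `[0, T) × ℝ`. -/
def SpaceTimeSmooth (T : ℝ) (f : ℝ → ℝ → ℝ) : Prop :=
  ContDiffOn ℝ (⊤ : ℕ∞) (Function.uncurry f) (Set.Ico 0 T ×ˢ Set.univ)

namespace SpaceTimeSmooth

variable {T : ℝ} {f g : ℝ → ℝ → ℝ}

theorem const (c : ℝ) : SpaceTimeSmooth T fun _ _ => c := contDiffOn_const

theorem add (hf : SpaceTimeSmooth T f) (hg : SpaceTimeSmooth T g) :
    SpaceTimeSmooth T fun t u => f t u + g t u := ContDiffOn.add hf hg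

theorem sub (hf : SpaceTimeSmooth T f) (hg : SpaceTimeSmooth T g) :
    SpaceTimeSmooth T fun t u => f t u - g t u := ContDiffOn.sub hf hg

theorem mul (hf : SpaceTimeSmooth T f) (hg : SpaceTimeSmooth T g) :
    SpaceTimeSmooth T fun t u => f t u * g t u := ContDiffOn.mul hf hg

theorem inv (hf : SpaceTimeSmooth T f) (h : ∀ t ∈ Set.Ico 0 T, ∀ u, f t u ≠ 0) :
    SpaceTimeSmooth T fun t u => (f t u)⁻¹ :=
  ContDiffOn.inv hf fun p hp => h p.1 hp.1 p.2

theorem sqrt (hf : SpaceTimeSmooth T f) (h : ∀ t ∈ Set.Ico 0 T, ∀ u, f t u ≠ 0) :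
    SpaceTimeSmooth T fun t u => √(f t u) :=
  ContDiffOn.sqrt hf fun p hp => h p.1 hp.1 p.2

theorem congr (hf : SpaceTimeSmooth T f) (h : ∀ t ∈ Set.Ico 0 T, ∀ u, g t u = f t u) :
    SpaceTimeSmooth T g :=
  ContDiffOn.congr hf fun p hp => h p.1 hp.1 p.2

theorem contDiff (hf : SpaceTimeSmooth T f) {t : ℝ} (ht : t ∈ Set.Ico 0 T) :
    ContDiff ℝ (⊤ : ℕ∞) (f t) := by
  rw [← contDiffOn_univ]
  exact ContDiffOn.comp (g := Function.uncurry f) (f := fun u : ℝ => (t, u)) hf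
    (contDiff_const.prodMk contDiff_id).contDiffOn fun u _ => ⟨ht, trivial⟩

theorem differentiableAt (hf : SpaceTimeSmooth T f) {t : ℝ} (ht : t ∈ Set.Ico 0 T) (u : ℝ) :
    DifferentiableAt ℝ (f t) u :=
  (hf.contDiff ht).differentiable (by simp) u

theorem contDiffAt (hf : SpaceTimeSmooth T f) {t : ℝ} (ht : t ∈ Set.Ioo 0 T) (u : ℝ) :
    ContDiffAt ℝ (⊤ : ℕ∞) (Function.uncurry f) (t, u) :=
  ContDiffOn.contDiffAt hf (prod_mem_nhds (Ico_mem_nhds ht.1 ht.2) Filter.univ_mem)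

theorem deriv (hf : SpaceTimeSmooth T f) : SpaceTimeSmooth T fun t => deriv (f t) := by
  have hS : UniqueDiffOn ℝ (Set.Ico 0 T ×ˢ (Set.univ : Set ℝ)) :=
    (uniqueDiffOn_Ico 0 T).prod uniqueDiffOn_univ
  have h := (ContDiffOn.fderivWithin (m := (⊤ : ℕ∞)) hf hS (by simp)).clm_apply
    (contDiffOn_const (c := ((0 : ℝ), (1 : ℝ))))
  refine h.congr ?_
  rintro ⟨t, u⟩ hp
  have hd : HasFDerivWithinAt (Function.uncurry f)
      (fderivWithin ℝ (Function.uncurry f) (Set.Ico 0 T ×ˢ Set.univ) (t, u))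
      (Set.Ico 0 T ×ˢ Set.univ) (t, u) :=
    (ContDiffOn.differentiableOn hf (by simp) _ hp).hasFDerivWithinAt
  have hl : HasDerivWithinAt (fun u' : ℝ => (t, u')) ((0 : ℝ), (1 : ℝ)) Set.univ u :=
    ((hasDerivAt_const u t).prodMk (hasDerivAt_id u)).hasDerivWithinAt
  have := hd.comp_hasDerivWithinAt u hl (fun u' _ => ⟨hp.1, trivial⟩)
  exact (hasDerivWithinAt_univ.1 this).deriv

theorem hasDerivAt_fst (hf : SpaceTimeSmooth T f) {t : ℝ} (ht : t ∈ Set.Ioo 0 T) (u : ℝ) :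
    HasDerivAt (fun t' => f t' u) (fderiv ℝ (Function.uncurry f) (t, u) (1, 0)) t :=
  HasFDerivAt.comp_hasDerivAt (f := fun t' => (t', u)) (l := Function.uncurry f) t
    ((hf.contDiffAt ht u).differentiableAt (by simp)).hasFDerivAt
    ((hasDerivAt_id' t).prodMk (hasDerivAt_const t u))

theorem hasDerivAt_snd (hf : SpaceTimeSmooth T f) {t : ℝ} (ht : t ∈ Set.Ioo 0 T) (u : ℝ) :
    HasDerivAt (f t) (fderiv ℝ (Function.uncurry f) (t, u) (0, 1)) u :=
  HasFDerivAt.comp_hasDerivAt (f := fun u' => (t, u')) (l := Function.uncurry f) u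
    ((hf.contDiffAt ht u).differentiableAt (by simp)).hasFDerivAt
    ((hasDerivAt_const u t).prodMk (hasDerivAt_id' u))

/-- Time and space derivatives commute. -/
theorem hasDerivAt_deriv (hf : SpaceTimeSmooth T f) {t : ℝ} (ht : t ∈ Set.Ioo 0 T) {g : ℝ → ℝ}
    (hg : ∀ u, HasDerivAt (fun t' => f t' u) (g u) t) (u : ℝ) :
    HasDerivAt (fun t' => _root_.deriv (f t') u) (_root_.deriv g u) t := by
  have hC := hf.contDiffAt ht u
  have htwo : (2 : WithTop ℕ∞) ≤ ((⊤ : ℕ∞) : WithTop ℕ∞) := WithTop.coe_le_coe.2 le_top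
  have hsymm := hC.isSymmSndFDerivAt (by simpa using htwo)
  have hd : HasFDerivAt (fderiv ℝ (Function.uncurry f))
      (fderiv ℝ (fderiv ℝ (Function.uncurry f)) (t, u)) (t, u) :=
    ((hC.fderiv_right (m := 1) (by rw [one_add_one_eq_two]; exact htwo)).differentiableAt
      one_ne_zero).hasFDerivAt
  generalize hF : fderiv ℝ (Function.uncurry f) = F at hd
  have hsymm := hsymm (0, 1) (1, 0)
  rw [hF] at hsymm
  have hg' : g = fun u => F (t, u) (1, 0) :=
    funext fun u => (hg u).unique (hF ▸ hf.hasDerivAt_fst ht u)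
  have hl1 : HasDerivAt (fun u' : ℝ => (t, u')) ((0 : ℝ), (1 : ℝ)) u :=
    (hasDerivAt_const u t).prodMk (hasDerivAt_id' u)
  have hl2 : HasDerivAt (fun t' : ℝ => (t', u)) ((1 : ℝ), (0 : ℝ)) t :=
    (hasDerivAt_id' t).prodMk (hasDerivAt_const t u)
  have k1 := HasFDerivAt.comp_hasDerivAt (f := fun u' : ℝ => (t, u')) (l := F) u hd hl1
  have k2 := HasFDerivAt.comp_hasDerivAt (f := fun t' : ℝ => (t', u)) (l := F) t hd hl2
  have h1 : HasDerivAt g (fderiv ℝ F (t, u) (0, 1) (1, 0)) u := by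
    rw [hg']
    simpa using k1.clm_apply (hasDerivAt_const u ((1 : ℝ), (0 : ℝ)))
  have h2 : HasDerivAt (fun t' => F (t', u) (0, 1)) (fderiv ℝ F (t, u) (1, 0) (0, 1)) t := by
    simpa using k2.clm_apply (hasDerivAt_const t ((0 : ℝ), (1 : ℝ)))
  rw [h1.deriv, hsymm]
  refine h2.congr_of_eventuallyEq ?_
  filter_upwards [Ioo_mem_nhds ht.1 ht.2] with t' ht'
  exact hF ▸ (hf.hasDerivAt_snd ht' u).deriv

theorem continuousOn_integral (hf : SpaceTimeSmooth T f) :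
    ContinuousOn (fun t => ∫ u in (0 : ℝ)..1, f t u) (Set.Ico 0 T) := by
  rw [continuousOn_iff_continuous_domRestrict]
  have h : Continuous (Function.uncurry fun (t : Set.Ico 0 T) u => f t u) :=
    (ContDiffOn.continuousOn hf).comp_continuous (f := fun p : Set.Ico 0 T × ℝ => ((p.1 : ℝ), p.2))
      (by fun_prop) fun p => ⟨p.1.2, trivial⟩
  exact intervalIntegral.continuous_parametric_intervalIntegral_of_continuous' h 0 1

theorem hasDerivAt_integral (hf : SpaceTimeSmooth T f) {t : ℝ} (ht : t ∈ Set.Ioo 0 T) {g : ℝ → ℝ}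
    (hg : ∀ u, HasDerivAt (fun t' => f t' u) (g u) t) :
    HasDerivAt (fun t' => ∫ u in (0 : ℝ)..1, f t' u) (∫ u in (0 : ℝ)..1, g u) t := by
  obtain ⟨a, ha0, hat⟩ := exists_between ht.1
  obtain ⟨b, htb, hbT⟩ := exists_between ht.2
  set F' : ℝ → ℝ → ℝ := fun t u => fderiv ℝ (Function.uncurry f) (t, u) (1, 0) with hF'
  have hc : ∀ t ∈ Set.Ioo 0 T, ∀ u, ContinuousAt (Function.uncurry F') (t, u) := by
    intro t ht u
    have h1 : ContinuousAt (fderiv ℝ (Function.uncurry f)) (t, u) :=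
      ((hf.contDiffAt ht u).fderiv_right (m := 0) (by simp)).continuousAt
    exact h1.clm_apply continuousAt_const
  have hcont : ContinuousOn (Function.uncurry F') (Set.Icc a b ×ˢ Set.Icc 0 1) := by
    rintro ⟨t, u⟩ ⟨hp, -⟩
    exact (hc t ⟨ha0.trans_le hp.1, hp.2.trans_lt hbT⟩ u).continuousWithinAt
  obtain ⟨C, hC⟩ := (isCompact_Icc.prod isCompact_Icc).exists_bound_of_continuousOn hcont
  have hg' : g = F' t := funext fun u => (hg u).unique (hf.hasDerivAt_fst ht u)
  have hIoo : Set.Ioo 0 T ∈ nhds t := Ioo_mem_nhds ht.1 ht.2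
  rw [hg']
  refine (intervalIntegral.hasDerivAt_integral_of_dominated_loc_of_deriv_le (F := f) (F' := F')
    (bound := fun _ => C) (Icc_mem_nhds hat htb) ?_ ?_ ?_ ?_ ?_ ?_).2
  · filter_upwards [hIoo] with t' ht'
    exact (hf.contDiff ⟨ht'.1.le, ht'.2⟩).continuous.aestronglyMeasurable
  · exact (hf.contDiff ⟨ht.1.le, ht.2⟩).continuous.intervalIntegrable _ _
  · refine Continuous.aestronglyMeasurable ?_
    refine continuous_iff_continuousAt.2 fun u => ?_
    exact ContinuousAt.comp (f := fun u : ℝ => (t, u)) (hc t ht u) (by fun_prop)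
  · refine Filter.Eventually.of_forall fun u hu t' ht' => hC (t', u) ⟨ht', ?_⟩
    rw [Set.uIoc_of_le zero_le_one] at hu
    exact Set.Ioc_subset_Icc_self hu
  · exact intervalIntegrable_const
  · exact Filter.Eventually.of_forall fun u _ t' ht' =>
      hf.hasDerivAt_fst ⟨ha0.trans_le ht'.1, ht'.2.trans_lt hbT⟩ u

end SpaceTimeSmooth

theorem le_add_mul_of_hasDerivAt_le {T C : ℝ} {f : ℝ → ℝ} (hc : ContinuousOn f (Set.Ico 0 T))
    (hd : ∀ t ∈ Set.Ioo 0 T, ∃ f', HasDerivAt f f' t ∧ f' ≤ C) {t : ℝ} (ht : t ∈ Set.Ico 0 T) :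
    f t ≤ f 0 + C * t := by
  have hanti : AntitoneOn (fun t => f t - C * t) (Set.Ico 0 T) := by
    refine antitoneOn_of_deriv_nonpos (convex_Ico 0 T) (hc.sub (by fun_prop)) ?_ ?_ <;>
      rw [interior_Ico] <;> intro s hs <;> obtain ⟨f', h1, h2⟩ := hd s hs <;>
      have h3 := h1.sub ((hasDerivAt_id s).const_mul C)
    · exact h3.differentiableAt.differentiableWithinAt
    · rw [show (fun t => f t - C * t) = f - fun y => C * id y from rfl, h3.deriv]
      linarith
  have := hanti ⟨le_rfl, ht.1.trans_lt ht.2⟩ ht ht.1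
  simp only [mul_zero, sub_zero] at this
  linarith

/-- Smooth families of closed curves with speed `v`, where `κ j` is the `j`-th arclength derivative
of the curvature `κ 0`. -/
structure SmoothJet (T : ℝ) (v : ℝ → ℝ → ℝ) (κ : ℕ → ℝ → ℝ → ℝ) : Prop where
  speed : SpaceTimeSmooth T v
  curvature : SpaceTimeSmooth T (κ 0)
  pos : ∀ t ∈ Set.Ico 0 T, ∀ u, 0 < v t u
  speed_periodic : ∀ t ∈ Set.Ico 0 T, Function.Periodic (v t) 1
  curvature_periodic : ∀ t ∈ Set.Ico 0 T, Function.Periodic (κ 0 t) 1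
  succ : ∀ j t, κ (j + 1) t = aderiv (v t) (κ j t)

namespace SmoothJet

variable {T : ℝ} {v : ℝ → ℝ → ℝ} {κ : ℕ → ℝ → ℝ → ℝ}

theorem smooth (h : SmoothJet T v κ) (j : ℕ) : SpaceTimeSmooth T (κ j) := by
  induction j with
  | zero => exact h.curvature
  | succ j ih =>
    exact ((h.speed.inv fun t ht u => (h.pos t ht u).ne').mul ih.deriv).congr
      fun t _ u => congrFun (h.succ j t) u

theorem jet (h : SmoothJet T v κ) :
    ArcJet (fun t : Set.Ico 0 T => v t) (fun j (t : Set.Ico 0 T) => κ j t) where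
  speed t := ⟨h.speed.contDiff t.2, h.speed_periodic t t.2⟩
  pos t := h.pos t t.2
  smooth j t := by
    induction j with
    | zero => exact ⟨h.curvature.contDiff t.2, h.curvature_periodic t t.2⟩
    | succ j ih =>
      rw [h.succ]
      exact SmoothPeriodic.aderiv ⟨h.speed.contDiff t.2, h.speed_periodic t t.2⟩ (h.pos t t.2) ih
  succ j t := h.succ j t

theorem idealRem_subtype (j : ℕ) (t : Set.Ico 0 T) :
    idealRem (fun t : Set.Ico 0 T => v t) (fun j (t : Set.Ico 0 T) => κ j t) j t =
      idealRem v κ j t := by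
  induction j with
  | zero => rfl
  | succ j ih =>
    funext u
    simp only [idealRem, ih]
    rfl

end SmoothJet

/-- Evolution of the speed and of the curvature of closed curves moving with normal speed
`idealSpeed κ`. -/
structure IdealFlow (T : ℝ) (v : ℝ → ℝ → ℝ) (κ : ℕ → ℝ → ℝ → ℝ) : Prop
    extends SmoothJet T v κ where
  speed_deriv : ∀ t ∈ Set.Ioo 0 T, ∀ u,
    HasDerivAt (fun s => v s u) (-(κ 0 t u * idealSpeed κ t u * v t u)) t
  curvature_deriv : ∀ t ∈ Set.Ioo 0 T, ∀ u, HasDerivAt (fun s => κ 0 s u)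
    (aderiv (v t) (aderiv (v t) (idealSpeed κ t)) u + κ 0 t u * κ 0 t u * idealSpeed κ t u) t

namespace IdealFlow

variable {T : ℝ} {v : ℝ → ℝ → ℝ} {κ : ℕ → ℝ → ℝ → ℝ}

theorem hasDerivAt (h : IdealFlow T v κ) {t : ℝ} (ht : t ∈ Set.Ioo 0 T) (j : ℕ) (u : ℝ) :
    HasDerivAt (fun s => κ j s u) (κ (j + 6) t u + idealRem v κ j t u) t := by
  have ht' : t ∈ Set.Ico 0 T := ⟨ht.1.le, ht.2⟩
  induction j generalizing u with
  | zero =>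
    exact (h.curvature_deriv t ht u).congr_deriv
      (congrFun (idealRem_zero_eq h.jet ⟨t, ht'⟩) u).symm
  | succ j ih =>
    have hv := h.speed_deriv t ht u
    have hne := (h.pos t ht' u).ne'
    have hd := (hv.inv hne).mul ((h.smooth j).hasDerivAt_deriv ht ih u)
    have hrem : SmoothPeriodic (idealRem v κ j t) := by
      rw [← SmoothJet.idealRem_subtype j ⟨t, ht'⟩]
      exact (diffPoly_idealRem h.jet j).smooth h.jet ⟨t, ht'⟩
    have ha := congrFun (aderiv_add (v := v t) (h.jet.smooth (j + 6) ⟨t, ht'⟩) hrem) u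
    have e1 : (fun s => κ (j + 1) s u) = (fun s => v s u)⁻¹ * fun s => deriv (κ j s) u := by
      funext s
      exact congrFun (h.succ j s) u
    rw [e1]
    refine hd.congr_deriv ?_
    have e2 : κ (j + 1 + 6) t u = aderiv (v t) (κ (j + 6) t) u := congrFun (h.succ (j + 6) t) u
    simp only [idealRem]
    rw [e2, h.succ j]
    simp only [aderiv, Pi.inv_apply] at ha ⊢
    rw [mul_comm] at ha
    rw [← add_assoc, ← ha]
    field_simp
    ring

/-- First variation of arclength integrals. -/
theorem hasDerivAt_arcIntegral (h : IdealFlow T v κ) {t : ℝ} (ht : t ∈ Set.Ioo 0 T)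
    {f : ℝ → ℝ → ℝ} (hf : SpaceTimeSmooth T f) {g : ℝ → ℝ}
    (hg : ∀ u, HasDerivAt (fun s => f s u) (g u) t) :
    HasDerivAt (fun s => arcIntegral (v s) (f s))
      (arcIntegral (v t) fun u => g u + -1 * (f t u * (κ 0 t u * idealSpeed κ t u))) t := by
  refine ((hf.mul h.speed).hasDerivAt_integral ht
    fun u => (hg u).mul (h.speed_deriv t ht u)).congr_deriv ?_
  refine intervalIntegral.integral_congr fun u _ => ?_
  ring

theorem continuousOn_arcIntegral (h : IdealFlow T v κ) {f : ℝ → ℝ → ℝ} (hf : SpaceTimeSmooth T f) :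
    ContinuousOn (fun s => arcIntegral (v s) (f s)) (Set.Ico 0 T) :=
  (hf.mul h.speed).continuousOn_integral

theorem hasDerivAt_length (h : IdealFlow T v κ) {t : ℝ} (ht : t ∈ Set.Ioo 0 T) :
    HasDerivAt (fun s => arcIntegral (v s) fun _ => 1)
      (-arcIntegral (v t) fun u => κ 0 t u * idealSpeed κ t u) t := by
  refine (h.hasDerivAt_arcIntegral ht (.const 1)
    fun u => hasDerivAt_const t (1 : ℝ)).congr_deriv ?_
  simp only [one_mul, zero_add]
  rw [arcIntegral_const_mul, neg_one_mul]

theorem hasDerivAt_energy (h : IdealFlow T v κ) {t : ℝ} (ht : t ∈ Set.Ioo 0 T) :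
    HasDerivAt (fun s => arcIntegral (v s) fun u => κ 1 s u ^ 2)
      (-2 * arcIntegral (v t) fun u => idealSpeed κ t u ^ 2) t := by
  have hs : SpaceTimeSmooth T fun s u => κ 1 s u ^ 2 :=
    ((h.smooth 1).mul (h.smooth 1)).congr fun t _ u => sq _
  refine (h.hasDerivAt_arcIntegral ht hs (g := fun u => 2 * (κ 1 t u *
    (κ 7 t u + idealRem v κ 1 t u))) fun u => ?_).congr_deriv
      (integral_energy_deriv h.jet ⟨t, ht.1.le, ht.2⟩)
  refine ((h.hasDerivAt ht 1 u).pow 2).congr_deriv ?_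
  norm_num
  ring

theorem energy_le (h : IdealFlow T v κ) {t : ℝ} (ht : t ∈ Set.Ico 0 T) :
    (arcIntegral (v t) fun u => κ 1 t u ^ 2) ≤ arcIntegral (v 0) fun u => κ 1 0 u ^ 2 := by
  have := le_add_mul_of_hasDerivAt_le (C := 0)
    (h.continuousOn_arcIntegral (f := fun s u => κ 1 s u ^ 2)
      (((h.smooth 1).mul (h.smooth 1)).congr fun t _ u => sq _))
    (fun s hs => ⟨_, h.hasDerivAt_energy hs, by
      have : 0 ≤ arcIntegral (v s) fun u => idealSpeed κ s u ^ 2 :=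
        arcIntegral_nonneg (h.pos s ⟨hs.1.le, hs.2⟩) fun u => sq_nonneg _
      linarith⟩) ht
  simpa using this

/-- The total curvature is constant along the flow. -/
theorem total_curvature_eq (h : IdealFlow T v κ) {t : ℝ} (ht : t ∈ Set.Ico 0 T) :
    arcIntegral (v t) (κ 0 t) = arcIntegral (v 0) (κ 0 0) := by
  have hd : ∀ s ∈ Set.Ioo 0 T, HasDerivAt (fun s => arcIntegral (v s) (κ 0 s)) 0 s := fun s hs =>
    (h.hasDerivAt_arcIntegral hs h.curvature (h.hasDerivAt hs 0)).congr_deriv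
      (integral_curvature_deriv h.jet ⟨s, hs.1.le, hs.2⟩)
  have hc := h.continuousOn_arcIntegral h.curvature
  have h1 := le_add_mul_of_hasDerivAt_le (C := 0) hc (fun s hs => ⟨0, hd s hs, le_rfl⟩) ht
  have h2 := le_add_mul_of_hasDerivAt_le (C := 0) hc.neg
    (fun s hs => ⟨-0, (hd s hs).neg, by simp⟩) ht
  simp only [Pi.neg_apply, zero_mul, add_zero] at h1 h2
  linarith

theorem length_pos (h : IdealFlow T v κ) {t : ℝ} (ht : t ∈ Set.Ico 0 T) :
    0 < arcIntegral (v t) fun _ => 1 :=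
  arcIntegral_one_pos (h.speed.contDiff ht).continuous (h.pos t ht)

theorem length_deriv_le (h : IdealFlow T v κ) {t : ℝ} (ht : t ∈ Set.Ico 0 T) {L e q : ℝ}
    (hL : L = arcIntegral (v t) fun _ => 1) (he : e = arcIntegral (v t) fun u => κ 1 t u ^ 2)
    (hq : q = arcIntegral (v t) fun u => idealSpeed κ t u ^ 2) :
    -(L * ((e + q) / 2 + 5 / 8 * e ^ 2)) ≤
        -arcIntegral (v t) (fun u => κ 0 t u * idealSpeed κ t u) ∧
      -arcIntegral (v t) (fun u => κ 0 t u * idealSpeed κ t u) ≤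
        L * ((e + q) / 2 + 5 / 4 * e ^ 2) +
          15 / 4 * ((arcIntegral (v 0) (κ 0 0) / L) ^ 2 * e) :=
  length_deriv_bounds h.jet ⟨t, ht⟩ hL he hq (by
    rw [div_mul_cancel₀ _ (hL ▸ h.length_pos ht).ne']
    exact h.total_curvature_eq ht)

theorem exists_le_length (h : IdealFlow T v κ) :
    ∃ ℓ, 0 < ℓ ∧ ∀ t ∈ Set.Ico 0 T, ℓ ≤ arcIntegral (v t) fun _ => 1 := by
  set L : ℝ → ℝ := fun t => arcIntegral (v t) fun _ => 1 with hL
  set e : ℝ → ℝ := fun t => arcIntegral (v t) fun u => κ 1 t u ^ 2 with he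
  set C : ℝ := 1 / 2 * e 0 + 5 / 8 * e 0 ^ 2 with hC
  have he0 : ∀ t ∈ Set.Ico 0 T, 0 ≤ e t := fun t ht =>
    arcIntegral_nonneg (h.pos t ht) fun u => sq_nonneg _
  have hcL : ContinuousOn L (Set.Ico 0 T) := h.continuousOn_arcIntegral (.const 1)
  have hce : ContinuousOn e (Set.Ico 0 T) := h.continuousOn_arcIntegral
    (((h.smooth 1).mul (h.smooth 1)).congr fun t _ u => sq _)
  refine ⟨Real.exp (-(-Real.log (L 0) + 1 / 4 * e 0 + C * T)), Real.exp_pos _, fun t ht => ?_⟩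
  have hT : (0 : ℝ) ∈ Set.Ico 0 T := ⟨le_rfl, ht.1.trans_lt ht.2⟩
  have hC0 : 0 ≤ C := by
    have := he0 0 hT
    positivity
  have key := le_add_mul_of_hasDerivAt_le (C := C) (f := fun t => -Real.log (L t) + 1 / 4 * e t)
    ((hcL.log fun t ht => (h.length_pos ht).ne').neg.add (hce.const_mul _))
    (fun s hs => by
      have hs' : s ∈ Set.Ico 0 T := ⟨hs.1.le, hs.2⟩
      have hLs := h.length_pos hs'
      refine ⟨_, (((h.hasDerivAt_length hs).log hLs.ne').neg).add
        ((h.hasDerivAt_energy hs).const_mul (1 / 4)), ?_⟩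
      have h1 := (h.length_deriv_le hs' rfl rfl rfl).1
      have h2 := h.energy_le hs'
      have h3 := pow_le_pow_left₀ (he0 s hs') h2 2
      rw [neg_le, ← div_le_iff₀' hLs] at h1
      rw [← neg_div]
      simp only [he, hC] at *
      linarith) ht
  have h4 := mul_le_mul_of_nonneg_left ht.2.le hC0
  have h5 := he0 t ht
  rw [← Real.le_log_iff_exp_le (h.length_pos ht)]
  linarith

theorem exists_length_le (h : IdealFlow T v κ) :
    ∃ Λ, ∀ t ∈ Set.Ico 0 T, (arcIntegral (v t) fun _ => 1) ≤ Λ := by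
  obtain ⟨ℓ, hℓ, hle⟩ := h.exists_le_length
  set L : ℝ → ℝ := fun t => arcIntegral (v t) fun _ => 1 with hL
  set e : ℝ → ℝ := fun t => arcIntegral (v t) fun u => κ 1 t u ^ 2 with he
  set Θ : ℝ := arcIntegral (v 0) (κ 0 0) with hΘ
  set C : ℝ := 1 / 2 * e 0 + 5 / 4 * e 0 ^ 2 + 15 / 4 * (Θ ^ 2 * e 0) / ℓ ^ 3 with hC
  have he0 : ∀ t ∈ Set.Ico 0 T, 0 ≤ e t := fun t ht =>
    arcIntegral_nonneg (h.pos t ht) fun u => sq_nonneg _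
  have hcL : ContinuousOn L (Set.Ico 0 T) := h.continuousOn_arcIntegral (.const 1)
  have hce : ContinuousOn e (Set.Ico 0 T) := h.continuousOn_arcIntegral
    (((h.smooth 1).mul (h.smooth 1)).congr fun t _ u => sq _)
  refine ⟨Real.exp (Real.log (L 0) + 1 / 4 * e 0 + C * T), fun t ht => ?_⟩
  have hT : (0 : ℝ) ∈ Set.Ico 0 T := ⟨le_rfl, ht.1.trans_lt ht.2⟩
  have hC0 : 0 ≤ C := by
    have := he0 0 hT
    positivity
  have key := le_add_mul_of_hasDerivAt_le (C := C) (f := fun t => Real.log (L t) + 1 / 4 * e t)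
    ((hcL.log fun t ht => (h.length_pos ht).ne').add (hce.const_mul _))
    (fun s hs => by
      have hs' : s ∈ Set.Ico 0 T := ⟨hs.1.le, hs.2⟩
      have hLs := h.length_pos hs'
      refine ⟨_, ((h.hasDerivAt_length hs).log hLs.ne').add
        ((h.hasDerivAt_energy hs).const_mul (1 / 4)), ?_⟩
      have h1 := (h.length_deriv_le hs' rfl rfl rfl).2
      have h2 := h.energy_le hs'
      have h3 := pow_le_pow_left₀ (he0 s hs') h2 2
      have h4 : 15 / 4 * ((Θ / L s) ^ 2 * e s) / L s ≤ 15 / 4 * (Θ ^ 2 * e 0) / ℓ ^ 3 := by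
        have h5 : 15 / 4 * ((Θ / L s) ^ 2 * e s) / L s = 15 / 4 * (Θ ^ 2 * e s) / L s ^ 3 := by
          field_simp
        rw [h5]
        have h6 := hle s hs'
        have := he0 0 hT
        gcongr
      have h7 := div_le_div_of_nonneg_right h1 hLs.le
      rw [add_div, mul_div_cancel_left₀ _ hLs.ne'] at h7
      have h8 := h7.trans (add_le_add_right h4 _)
      simp only [he, hC] at *
      linarith) ht
  have h4 := mul_le_mul_of_nonneg_left ht.2.le hC0
  have h5 := he0 t ht
  rw [← Real.log_le_iff_le_exp (h.length_pos ht)]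
  linarith

theorem exists_curvature_le (h : IdealFlow T v κ) :
    ∃ M, ∀ t ∈ Set.Ico 0 T, ∀ u ∈ Set.Icc (0 : ℝ) 1, |κ 0 t u| ≤ M := by
  obtain ⟨ℓ, hℓ, hle⟩ := h.exists_le_length
  obtain ⟨Λ, hΛ⟩ := h.exists_length_le
  refine ⟨√Λ * √(arcIntegral (v 0) fun u => κ 1 0 u ^ 2) + |arcIntegral (v 0) (κ 0 0)| / ℓ,
    fun t ht u hu => ?_⟩
  have hL := h.length_pos ht
  have h1 := abs_sub_mean_le (h.jet.speed ⟨t, ht⟩) (h.pos t ht) (h.jet.smooth 0 ⟨t, ht⟩)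
    (c := arcIntegral (v 0) (κ 0 0) / arcIntegral (v t) fun _ => 1)
    (by rw [div_mul_cancel₀ _ hL.ne']; exact h.total_curvature_eq ht) hu
  rw [← h.jet.succ] at h1
  have h2 := (abs_sub_abs_le_abs_sub (κ 0 t u) _).trans h1
  rw [sub_le_iff_le_add] at h2
  refine h2.trans (add_le_add (mul_le_mul (Real.sqrt_le_sqrt (hΛ t ht))
    (Real.sqrt_le_sqrt (h.energy_le ht)) (Real.sqrt_nonneg _) (Real.sqrt_nonneg _)) ?_)
  rw [abs_div, abs_of_pos hL]
  exact div_le_div_of_nonneg_left (abs_nonneg _) hℓ (hle t ht)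

/-- On a bounded time interval the length and the `L²` norm of `κ 5` stay bounded. -/
theorem exists_bound (h : IdealFlow T v κ) :
    ∃ C, ∀ t ∈ Set.Ico 0 T,
      (arcIntegral (v t) fun _ => 1) + (arcIntegral (v t) fun u => κ 5 t u ^ 2) ≤ C := by
  obtain ⟨Λ, hΛ⟩ := h.exists_length_le
  obtain ⟨K, hK⟩ := h.exists_curvature_le
  set E := arcIntegral (v 0) fun u => κ 1 0 u ^ 2 with hE
  set M := max 1 (max √Λ (max √E K)) with hM
  obtain ⟨C, hC⟩ := exists_energy_deriv_le h.jet (M := M) (le_max_left _ _)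
    (fun t => (Real.sqrt_le_sqrt (hΛ t t.2)).trans (by simp [hM]))
    (fun t => (Real.sqrt_le_sqrt (h.energy_le t.2)).trans (by simp [hM, hE]))
    (fun t u hu => (hK t t.2 u hu).trans (by simp [hM]))
  have hs : SpaceTimeSmooth T fun s u => κ 5 s u ^ 2 :=
    ((h.smooth 5).mul (h.smooth 5)).congr fun t _ u => sq _
  refine ⟨Λ + ((arcIntegral (v 0) fun u => κ 5 0 u ^ 2) + |C| * T), fun t ht => ?_⟩
  refine add_le_add (hΛ t ht) ?_
  have key := le_add_mul_of_hasDerivAt_le (C := |C|) (h.continuousOn_arcIntegral hs)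
    (fun s hs' => by
      have hs'' : s ∈ Set.Ico 0 T := ⟨hs'.1.le, hs'.2⟩
      refine ⟨_, h.hasDerivAt_arcIntegral hs' hs (g := fun u => 2 * (κ 5 s u *
        (κ 11 s u + idealRem v κ 5 s u))) fun u => ?_, ?_⟩
      · refine ((h.hasDerivAt hs' 5 u).pow 2).congr_deriv ?_
        norm_num
        ring
      · refine le_trans (le_of_eq ?_) ((hC ⟨s, hs''⟩).trans (le_abs_self C))
        rw [SmoothJet.idealRem_subtype]
        congr 1
        funext u
        simp only [idealSpeed, idealNonlin]
        ring) ht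
  exact key.trans (add_le_add_right (mul_le_mul_of_nonneg_left ht.2.le (abs_nonneg C)) _)

end IdealFlow

theorem idealFlow_of_frenet {T : ℝ} {x y a b v : ℝ → ℝ → ℝ} {κ : ℕ → ℝ → ℝ → ℝ}
    (hJ : SmoothJet T v κ) (hx : SpaceTimeSmooth T x) (hy : SpaceTimeSmooth T y)
    (ha : SpaceTimeSmooth T a) (hb : SpaceTimeSmooth T b)
    (hab : ∀ t ∈ Set.Ico 0 T, ∀ u, a t u ^ 2 + b t u ^ 2 = 1)
    (hxu : ∀ t ∈ Set.Ico 0 T, ∀ u, deriv (x t) u = v t u * a t u)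
    (hyu : ∀ t ∈ Set.Ico 0 T, ∀ u, deriv (y t) u = v t u * b t u)
    (hau : ∀ t ∈ Set.Ico 0 T, ∀ u, deriv (a t) u = -(v t u * κ 0 t u * b t u))
    (hbu : ∀ t ∈ Set.Ico 0 T, ∀ u, deriv (b t) u = v t u * κ 0 t u * a t u)
    (hxt : ∀ t ∈ Set.Ioo 0 T, ∀ u,
      HasDerivAt (fun s => x s u) (-(idealSpeed κ t u * b t u)) t)
    (hyt : ∀ t ∈ Set.Ioo 0 T, ∀ u, HasDerivAt (fun s => y s u) (idealSpeed κ t u * a t u) t) :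
    IdealFlow T v κ := by
  have hnear : ∀ t ∈ Set.Ioo 0 T, ∀ᶠ s in nhds t, s ∈ Set.Ico 0 T := fun t ht =>
    Ico_mem_nhds ht.1 ht.2
  have hspeed : ∀ t ∈ Set.Ioo 0 T, ∀ u,
      HasDerivAt (fun s => v s u) (-(κ 0 t u * idealSpeed κ t u * v t u)) t ∧
      HasDerivAt (fun s => a s u) (-(aderiv (v t) (idealSpeed κ t) u * b t u)) t ∧
      HasDerivAt (fun s => b s u) (aderiv (v t) (idealSpeed κ t) u * a t u) t := by
    intro t ht u
    have ht' : t ∈ Set.Ico 0 T := ⟨ht.1.le, ht.2⟩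
    have hF : HasDerivAt (idealSpeed κ t) (deriv (idealSpeed κ t) u) u :=
      ((diffPoly_idealSpeed.smooth hJ.jet ⟨t, ht'⟩).differentiable u).hasDerivAt
    have ha1 := (ha.differentiableAt ht' u).hasDerivAt
    have hb1 := (hb.differentiableAt ht' u).hasDerivAt
    have hv' := hJ.speed.hasDerivAt_fst ht u
    have ha' := ha.hasDerivAt_fst ht u
    have hb' := hb.hasDerivAt_fst ht u
    generalize fderiv ℝ (Function.uncurry v) (t, u) (1, 0) = dv at hv'
    generalize fderiv ℝ (Function.uncurry a) (t, u) (1, 0) = da at ha'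
    generalize fderiv ℝ (Function.uncurry b) (t, u) (1, 0) = db at hb'
    have hX := (hx.hasDerivAt_deriv ht (hxt t ht) u).unique ((hv'.mul ha').congr_of_eventuallyEq
      ((hnear t ht).mono fun s hs => hxu s hs u))
    have hY := (hy.hasDerivAt_deriv ht (hyt t ht) u).unique ((hv'.mul hb').congr_of_eventuallyEq
      ((hnear t ht).mono fun s hs => hyu s hs u))
    have hU := ((ha'.pow 2).add (hb'.pow 2)).unique ((hasDerivAt_const t (1 : ℝ)).congr_of_eventuallyEq
      ((hnear t ht).mono fun s hs => hab s hs u))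
    have hX1 := ((hF.mul hb1).neg).deriv
    have hY1 := (hF.mul ha1).deriv
    rw [hbu t ht'] at hX1
    rw [hau t ht'] at hY1
    have hX2 := hX1.symm.trans hX
    have hY2 := hY1.symm.trans hY
    have hab' := hab t ht' u
    have hne := (hJ.pos t ht' u).ne'
    norm_num at hU
    simp only [aderiv]
    generalize deriv (idealSpeed κ t) u = DF at *
    generalize idealSpeed κ t u = F at *
    generalize κ 0 t u = k at *
    have e1 : dv = -(k * F * v t u) := by
      linear_combination (-dv - k * F * v t u) * hab' - a t u * hX2 - b t u * hY2 - v t u / 2 * hU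
    have e2 : v t u * (a t u * db - b t u * da) = DF := by
      linear_combination b t u * hX2 - a t u * hY2 + DF * hab'
    refine ⟨e1 ▸ hv', ha'.congr_deriv ?_, hb'.congr_deriv ?_⟩
    · rw [← e2]
      field_simp
      linear_combination (-da) * hab' + a t u / 2 * hU
    · rw [← e2]
      field_simp
      linear_combination (-db) * hab' + b t u / 2 * hU
  refine ⟨hJ, fun t ht u => (hspeed t ht u).1, fun t ht u => ?_⟩
  have ht' : t ∈ Set.Ico 0 T := ⟨ht.1.le, ht.2⟩
  obtain ⟨hv', ha', hb'⟩ := hspeed t ht u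
  have hk' := hJ.curvature.hasDerivAt_fst ht u
  have hω : HasDerivAt (aderiv (v t) (idealSpeed κ t)) (deriv (aderiv (v t) (idealSpeed κ t)) u) u :=
    (((hJ.jet.speed ⟨t, ht'⟩).aderiv (hJ.pos t ht')
      (diffPoly_idealSpeed.smooth hJ.jet ⟨t, ht'⟩)).differentiable u).hasDerivAt
  have ha1 := (ha.differentiableAt ht' u).hasDerivAt
  have hb1 := (hb.differentiableAt ht' u).hasDerivAt
  have hA := ha.hasDerivAt_deriv ht (fun u => (hspeed t ht u).2.1) u
  have hB := hb.hasDerivAt_deriv ht (fun u => (hspeed t ht u).2.2) u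
  have hA1 := ((hω.mul hb1).neg).deriv
  have hB1 := (hω.mul ha1).deriv
  have hK := ((ha'.mul hB).sub (hb'.mul hA)).unique ((hv'.mul hk').congr_of_eventuallyEq
    ((hnear t ht).mono fun s hs => by
      simp only [Pi.mul_apply, Pi.sub_apply]
      rw [hau s hs, hbu s hs]
      linear_combination v s u * κ 0 s u * hab s hs u))
  refine hk'.congr_deriv ?_
  have hab' := hab t ht' u
  have hne := (hJ.pos t ht' u).ne'
  rw [hbu t ht'] at hA1
  rw [hau t ht'] at hB1
  have hA2 : deriv (fun u => -(aderiv (v t) (idealSpeed κ t) u * b t u)) u = _ := hA1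
  have hB2 : deriv (fun u => aderiv (v t) (idealSpeed κ t) u * a t u) u = _ := hB1
  rw [hA2, hB2, hau t ht', hbu t ht'] at hK
  generalize fderiv ℝ (Function.uncurry (κ 0)) (t, u) (1, 0) = dk at *
  have e3 : aderiv (v t) (aderiv (v t) (idealSpeed κ t)) u =
    (v t u)⁻¹ * deriv (aderiv (v t) (idealSpeed κ t)) u := rfl
  rw [e3]
  generalize deriv (aderiv (v t) (idealSpeed κ t)) u = dω at *
  generalize aderiv (v t) (idealSpeed κ t) u = ω at *
  field_simp
  linear_combination dω * hab' - hK

theorem idealFlow_of_curve {T : ℝ} {γ τ : ℝ → ℝ → EuclideanSpace ℝ (Fin 2)} {v k : ℝ → ℝ → ℝ}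
    (hγ : ContDiffOn ℝ (⊤ : ℕ∞) (Function.uncurry γ) (Set.Ico 0 T ×ˢ Set.univ))
    (hclosed : ∀ t ∈ Set.Ico 0 T, Function.Periodic (γ t) 1)
    (hvpos : ∀ t ∈ Set.Ico 0 T, ∀ u, 0 < v t u)
    (hv : ∀ t ∈ Set.Ico 0 T, ∀ u, v t u = ‖deriv (γ t) u‖)
    (hτ : ∀ t ∈ Set.Ico 0 T, ∀ u, deriv (γ t) u = v t u • τ t u)
    (hfrenet : ∀ t ∈ Set.Ico 0 T, ∀ u, deriv (τ t) u = (v t u * k t u) • rot2 (τ t u))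
    (hflow : ∀ t ∈ Set.Ico 0 T, ∀ u,
      derivWithin (fun t' => γ t' u) (Set.Ico 0 T) t = Kop (v t) (k t) u • rot2 (τ t u)) :
    IdealFlow T v fun j t => (aderiv (v t))^[j] (k t) := by
  have hcoord : ∀ {f : ℝ → EuclideanSpace ℝ (Fin 2)} {f' : EuclideanSpace ℝ (Fin 2)} {t : ℝ},
      DifferentiableAt ℝ f t → deriv f t = f' → ∀ i, HasDerivAt (fun s => f s i) (f' i) t :=
    fun hf h i => ((EuclideanSpace.proj (𝕜 := ℝ) i).hasFDerivAt.comp_hasDerivAt _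
      (h ▸ hf.hasDerivAt))
  have hrot0 : ∀ p, rot2 p 0 = -p 1 := fun p => rfl
  have hrot1 : ∀ p, rot2 p 1 = p 0 := fun p => rfl
  have hx : ∀ i, SpaceTimeSmooth T fun t u => γ t u i := fun i => contDiffOn_euclidean.1 hγ i
  have hγu : ∀ t ∈ Set.Ico 0 T, ∀ u, DifferentiableAt ℝ (γ t) u := fun t ht u =>
    differentiableAt_euclidean.2 fun i => (hx i).differentiableAt ht u
  have hxu : ∀ i, ∀ t ∈ Set.Ico 0 T, ∀ u, deriv (fun u => γ t u i) u = v t u * τ t u i :=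
    fun i t ht u => (hcoord (hγu t ht u) (hτ t ht u) i).deriv
  have hunit : ∀ t ∈ Set.Ico 0 T, ∀ u, τ t u 0 ^ 2 + τ t u 1 ^ 2 = 1 := by
    intro t ht u
    have h := hv t ht u
    rw [hτ t ht u, norm_smul, Real.norm_of_nonneg (hvpos t ht u).le, eq_comm,
      mul_eq_left₀ (hvpos t ht u).ne', EuclideanSpace.norm_eq, Real.sqrt_eq_one,
      Fin.sum_univ_two] at h
    simpa using h
  have hvs : SpaceTimeSmooth T v := by
    have hs := ((hx 0).deriv.mul (hx 0).deriv).add ((hx 1).deriv.mul (hx 1).deriv)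
    have hsq : ∀ t ∈ Set.Ico 0 T, ∀ u, deriv (fun u => γ t u 0) u * deriv (fun u => γ t u 0) u +
        deriv (fun u => γ t u 1) u * deriv (fun u => γ t u 1) u = v t u ^ 2 := by
      intro t ht u
      rw [hxu 0 t ht, hxu 1 t ht]
      linear_combination v t u ^ 2 * hunit t ht u
    refine (hs.sqrt fun t ht u => ?_).congr fun t ht u => ?_
    · rw [hsq t ht u]
      exact pow_ne_zero 2 (hvpos t ht u).ne'
    · rw [hsq t ht u, Real.sqrt_sq (hvpos t ht u).le]
  have hvinv := hvs.inv fun t ht u => (hvpos t ht u).ne'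
  have hτa : ∀ i, ∀ t ∈ Set.Ico 0 T, ∀ u, τ t u i = aderiv (v t) (fun u => γ t u i) u := by
    intro i t ht u
    rw [aderiv, hxu i t ht, inv_mul_cancel_left₀ (hvpos t ht u).ne']
  have hτs : ∀ i, SpaceTimeSmooth T fun t u => τ t u i := fun i =>
    (hvinv.mul (hx i).deriv).congr fun t ht u => hτa i t ht u
  have hτu : ∀ t ∈ Set.Ico 0 T, ∀ u i,
      HasDerivAt (fun u => τ t u i) (v t u * k t u * rot2 (τ t u) i) u := fun t ht u =>
    hcoord (differentiableAt_euclidean.2 fun i => (hτs i).differentiableAt ht u) (hfrenet t ht u)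
  have hka : ∀ t ∈ Set.Ico 0 T, ∀ u, k t u = τ t u 0 * aderiv (v t) (fun u => τ t u 1) u -
      τ t u 1 * aderiv (v t) (fun u => τ t u 0) u := by
    intro t ht u
    rw [aderiv, aderiv, (hτu t ht u 0).deriv, (hτu t ht u 1).deriv, hrot0, hrot1]
    have := (hvpos t ht u).ne'
    field_simp
    linear_combination -(k t u) * hunit t ht u
  have hγp : ∀ t ∈ Set.Ico 0 T, ∀ i, SmoothPeriodic fun u => γ t u i := fun t ht i =>
    ⟨(hx i).contDiff ht, fun u => by rw [hclosed t ht u]⟩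
  have hvp : ∀ t ∈ Set.Ico 0 T, SmoothPeriodic (v t) := fun t ht =>
    ⟨hvs.contDiff ht, fun u => by
      rw [hv t ht, hv t ht, ← deriv_comp_add_const, funext (hclosed t ht)]⟩
  have hτp : ∀ t ∈ Set.Ico 0 T, ∀ i, SmoothPeriodic fun u => τ t u i := fun t ht i => by
    rw [funext (hτa i t ht)]
    exact (hvp t ht).aderiv (hvpos t ht) (hγp t ht i)
  have hkp : ∀ t ∈ Set.Ico 0 T, SmoothPeriodic (k t) := fun t ht => by
    rw [funext (hka t ht)]
    exact ((hτp t ht 0).mul ((hvp t ht).aderiv (hvpos t ht) (hτp t ht 1))).sub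
      ((hτp t ht 1).mul ((hvp t ht).aderiv (hvpos t ht) (hτp t ht 0)))
  have hks : SpaceTimeSmooth T k :=
    (((hτs 0).mul (hvinv.mul (hτs 1).deriv)).sub ((hτs 1).mul (hvinv.mul (hτs 0).deriv))).congr hka
  have hjet : SmoothJet T v fun j t => (aderiv (v t))^[j] (k t) :=
    ⟨hvs, hks, hvpos, fun t ht => (hvp t ht).periodic, fun t ht => (hkp t ht).periodic,
      fun j t => Function.iterate_succ_apply' _ _ _⟩
  have hF : ∀ t u, Kop (v t) (k t) u =
      idealSpeed (fun j t => (aderiv (v t))^[j] (k t)) t u := by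
    intro t u
    simp only [Kop, idealSpeed, idealNonlin, Function.iterate_zero, Function.iterate_one, id]
    ring
  have hγt : ∀ t ∈ Set.Ioo 0 T, ∀ u i, HasDerivAt (fun s => γ s u i)
      (idealSpeed (fun j t => (aderiv (v t))^[j] (k t)) t u * rot2 (τ t u) i) t := by
    intro t ht u
    have h := hflow t ⟨ht.1.le, ht.2⟩ u
    rw [derivWithin_of_mem_nhds (Ico_mem_nhds ht.1 ht.2), hF] at h
    exact hcoord (differentiableAt_euclidean.2 fun i =>
      ((hx i).hasDerivAt_fst ht u).differentiableAt) h
  refine idealFlow_of_frenet hjet (hx 0) (hx 1) (hτs 0) (hτs 1) hunit (hxu 0) (hxu 1)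
    (fun t ht u => ?_) (fun t ht u => (hτu t ht u 1).deriv) (fun t ht u => ?_)
    (fun t ht u => hγt t ht u 1)
  · rw [(hτu t ht u 0).deriv, hrot0, mul_neg]
    rfl
  · rw [← mul_neg]
    exact hγt t ht u 0

/-- Global existence: a maximal solution of the ideal curve flow
`∂_t γ = (k_ssss + k²k_ss − ½kk_s²)ν` on `[0,T)` with smooth closed immersed initial
data has `T = ∞`.  Maximality is encoded via the blow-up criterion of local
well-posedness: if `T < ∞` then `L + ∫ k_{s⁵}² ds` is unbounded on `[0,T)`. -/
theorem ideal_flow_global_existence (T : ℝ≥0∞) (hT : 0 < T)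
    (γ τ : ℝ → ℝ → EuclideanSpace ℝ (Fin 2)) (v k : ℝ → ℝ → ℝ)
    (hγ : ContDiffOn ℝ (⊤ : ℕ∞) (Function.uncurry γ) (timeSet T ×ˢ Set.univ))
    (hclosed : ∀ t ∈ timeSet T, Function.Periodic (γ t) 1)
    (hvpos : ∀ t ∈ timeSet T, ∀ u, 0 < v t u)
    (hv : ∀ t ∈ timeSet T, ∀ u, v t u = ‖deriv (γ t) u‖)
    (hτ : ∀ t ∈ timeSet T, ∀ u, deriv (γ t) u = v t u • τ t u)
    (hfrenet : ∀ t ∈ timeSet T, ∀ u, deriv (τ t) u = (v t u * k t u) • rot2 (τ t u))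
    (hflow : ∀ t ∈ timeSet T, ∀ u,
      derivWithin (fun t' => γ t' u) (timeSet T) t = Kop (v t) (k t) u • rot2 (τ t u))
    (hmax : T ≠ ⊤ → ∀ C : ℝ, ∃ t ∈ timeSet T,
      C < (∫ u in (0:ℝ)..1, v t u) + ∫ u in (0:ℝ)..1, ((aderiv (v t))^[5] (k t) u) ^ 2 * v t u) :
    T = ⊤ := by
  by_contra hne
  have hJ : timeSet T = Set.Ico 0 T.toReal := by
    ext t
    refine and_congr_right fun ht => ?_
    rw [← ENNReal.ofReal_lt_ofReal_iff_of_nonneg ht, ENNReal.ofReal_toReal hne]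
  rw [hJ] at hγ hclosed hvpos hv hτ hfrenet hflow hmax
  have hflow' := idealFlow_of_curve hγ hclosed hvpos hv hτ hfrenet hflow
  obtain ⟨C, hC⟩ := hflow'.exists_bound
  obtain ⟨t, ht, h⟩ := hmax hne C
  refine h.not_ge (le_trans (le_of_eq ?_) (hC t ht))
  simp only [arcIntegral, one_mul]
end

section
/- There exist constants Ĉ_ω and ε₀ > 0 depending only on ω such that every smooth closed immersed planar curve with winding number ω and L³E[γ] < ε₀ satisfies ∫_γ K² ds ≥ Ĉ_ω L^{−6} E, where K = k_ssss + k²k_ss − (1/2)k k_s² and E = (1/2)∫_γ k_s² ds. -/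
open Real MeasureTheory

/-- The ideal-curve Euler–Lagrange operator `K = k_ssss + k² k_ss − ½ k k_s²`
for an arclength-parametrized curve with curvature `k`. -/
noncomputable def Kop1 (k : ℝ → ℝ) (s : ℝ) : ℝ :=
  iteratedDeriv 4 k s + (k s) ^ 2 * iteratedDeriv 2 k s - (1 / 2) * k s * (deriv k s) ^ 2

theorem sq_intervalIntegral_le {a b : ℝ} (hab : a ≤ b) {h : ℝ → ℝ} (hc : Continuous h) :
    (∫ s in a..b, h s) ^ 2 ≤ (b - a) * ∫ s in a..b, h s ^ 2 := by
  rcases hab.eq_or_lt with rfl | hlt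
  · simp
  set I := ∫ s in a..b, h s with hI
  have hpos : 0 < b - a := sub_pos.2 hlt
  have key : 0 ≤ ∫ s in a..b, ((b - a) * h s - I) ^ 2 :=
    intervalIntegral.integral_nonneg hab fun s _ => sq_nonneg _
  have e : ∫ s in a..b, ((b - a) * h s - I) ^ 2
      = (b - a) ^ 2 * (∫ s in a..b, h s ^ 2) - 2 * (b - a) * I * I + (b - a) * I ^ 2 := by
    have : (fun s => ((b - a) * h s - I) ^ 2)
        = fun s => (b - a) ^ 2 * h s ^ 2 - 2 * (b - a) * I * h s + I ^ 2 := by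
      funext s; ring
    rw [this, intervalIntegral.integral_add, intervalIntegral.integral_sub,
      intervalIntegral.integral_const_mul, intervalIntegral.integral_const_mul,
      intervalIntegral.integral_const, smul_eq_mul] <;>
    exact Continuous.intervalIntegrable (by fun_prop) _ _
  rw [e] at key
  have : 0 ≤ (b - a) * ((b - a) * (∫ s in a..b, h s ^ 2) - I ^ 2) := by linarith
  linarith [nonneg_of_mul_nonneg_right this hpos]

theorem sq_sub_le_integral_deriv_sq {T : ℝ} {h h' : ℝ → ℝ} (hd : ∀ s, HasDerivAt h (h' s) s)
    (hc : Continuous h') {s t : ℝ} (hs : s ∈ Set.Icc 0 T) (ht : t ∈ Set.Icc 0 T) :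
    (h s - h t) ^ 2 ≤ T * ∫ r in (0:ℝ)..T, h' r ^ 2 := by
  wlog hts : t ≤ s generalizing s t
  · rw [← neg_sub, neg_sq]
    exact this ht hs (le_of_not_ge hts)
  rw [← intervalIntegral.integral_eq_sub_of_hasDerivAt (fun r _ => hd r)
    (hc.intervalIntegrable _ _)]
  have hI (a b : ℝ) : IntervalIntegrable (fun r => h' r ^ 2) volume a b :=
    Continuous.intervalIntegrable (by fun_prop) _ _
  have mono : ∫ r in t..s, h' r ^ 2 ≤ ∫ r in (0:ℝ)..T, h' r ^ 2 :=
    intervalIntegral.integral_mono_interval ht.1 hts hs.2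
      (Filter.Eventually.of_forall fun r => sq_nonneg _) (hI _ _)
  refine (sq_intervalIntegral_le hts hc).trans ?_
  have : 0 ≤ ∫ r in t..s, h' r ^ 2 :=
    intervalIntegral.integral_nonneg hts fun r _ => sq_nonneg _
  exact mul_le_mul (by linarith [ht.1, hs.2]) mono this (by linarith [ht.1, hs.2])

theorem exists_mul_eq_intervalIntegral {T : ℝ} (hT : 0 < T) {h : ℝ → ℝ} (hc : Continuous h) :
    ∃ t ∈ Set.Icc 0 T, T * h t = ∫ s in (0:ℝ)..T, h s := by
  obtain ⟨t, ht, e⟩ := exists_deriv_eq_slope (fun s => ∫ r in (0:ℝ)..s, h r) hT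
    (Continuous.continuousOn (intervalIntegral.continuous_primitive
      (fun a b => hc.intervalIntegrable a b) 0))
    (fun s _ => (hc.integral_hasStrictDerivAt 0 s).hasDerivAt.differentiableAt.differentiableWithinAt)
  refine ⟨t, Set.Ioo_subset_Icc_self ht, ?_⟩
  rw [hc.deriv_integral] at e
  simp only [intervalIntegral.integral_same, sub_zero] at e
  rw [e]; field_simp

theorem sq_sub_mean_le {T : ℝ} (hT : 0 < T) {h h' : ℝ → ℝ} (hd : ∀ s, HasDerivAt h (h' s) s)
    (hc : Continuous h') {s : ℝ} (hs : s ∈ Set.Icc 0 T) :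
    (h s - (∫ r in (0:ℝ)..T, h r) / T) ^ 2 ≤ T * ∫ r in (0:ℝ)..T, h' r ^ 2 := by
  obtain ⟨t, ht, e⟩ := exists_mul_eq_intervalIntegral hT
    (continuous_iff_continuousAt.2 fun s => (hd s).continuousAt)
  rw [← e, mul_div_cancel_left₀ _ hT.ne']
  exact sq_sub_le_integral_deriv_sq hd hc hs ht

theorem integral_le_mul_of_le {T C : ℝ} (hT : 0 ≤ T) {h : ℝ → ℝ} (hc : Continuous h)
    (hle : ∀ s ∈ Set.Icc 0 T, h s ≤ C) : ∫ s in (0:ℝ)..T, h s ≤ T * C := by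
  have := intervalIntegral.integral_mono_on hT (hc.intervalIntegrable 0 T)
    (continuous_const.intervalIntegrable (μ := volume) 0 T) hle
  simpa using this

theorem sq_le_of_integral_eq_zero {T : ℝ} (hT : 0 < T) {h h' : ℝ → ℝ}
    (hd : ∀ s, HasDerivAt h (h' s) s) (hc : Continuous h') (h0 : ∫ r in (0:ℝ)..T, h r = 0)
    {s : ℝ} (hs : s ∈ Set.Icc 0 T) : h s ^ 2 ≤ T * ∫ r in (0:ℝ)..T, h' r ^ 2 := by
  simpa [h0] using sq_sub_mean_le hT hd hc hs

theorem integral_sq_le_of_integral_eq_zero {T : ℝ} (hT : 0 < T) {h h' : ℝ → ℝ}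
    (hd : ∀ s, HasDerivAt h (h' s) s) (hc : Continuous h') (h0 : ∫ r in (0:ℝ)..T, h r = 0) :
    ∫ r in (0:ℝ)..T, h r ^ 2 ≤ T ^ 2 * ∫ r in (0:ℝ)..T, h' r ^ 2 := by
  have hch : Continuous h := continuous_iff_continuousAt.2 fun s => (hd s).continuousAt
  refine (integral_le_mul_of_le hT.le (by fun_prop)
    fun s hs => sq_le_of_integral_eq_zero hT hd hc h0 hs).trans_eq ?_
  ring

theorem integral_eq_zero_of_periodic {T : ℝ} {h h' : ℝ → ℝ}
    (hd : ∀ s, HasDerivAt h (h' s) s) (hc : Continuous h') (hp : Function.Periodic h T) :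
    ∫ r in (0:ℝ)..T, h' r = 0 := by
  rw [intervalIntegral.integral_eq_sub_of_hasDerivAt (fun r _ => hd r)
    (hc.intervalIntegrable _ _), hp.eq, sub_self]

theorem sq_integral_mul_comp_le {T W : ℝ} (hT : 0 < T) {u u' φ : ℝ → ℝ}
    (hd : ∀ s, HasDerivAt u (u' s) s) (hc : Continuous u') (h0 : ∫ r in (0:ℝ)..T, u r = 0)
    (hφ : Continuous φ) (hL : ∀ x y, |φ x - φ y| ≤ |x - y|)
    (hzero : ∫ s in (0:ℝ)..T, u s * φ (W * s + ∫ r in (0:ℝ)..s, u r) = 0) :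
    (∫ s in (0:ℝ)..T, u s * φ (W * s)) ^ 2 ≤ T ^ 6 * (∫ s in (0:ℝ)..T, u' s ^ 2) ^ 2 := by
  have hu : Continuous u := continuous_iff_continuousAt.2 fun s => (hd s).continuousAt
  set v : ℝ → ℝ := fun s => ∫ r in (0:ℝ)..s, u r with hv
  have hvd (s : ℝ) : HasDerivAt v (u s) s := (hu.integral_hasStrictDerivAt 0 s).hasDerivAt
  have hvc : Continuous v := continuous_iff_continuousAt.2 fun s => (hvd s).continuousAt
  set D := ∫ s in (0:ℝ)..T, u' s ^ 2 with hD
  have hD0 : 0 ≤ D := intervalIntegral.integral_nonneg hT.le fun s _ => sq_nonneg _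
  have e : ∫ s in (0:ℝ)..T, u s * φ (W * s)
      = ∫ s in (0:ℝ)..T, u s * (φ (W * s) - φ (W * s + v s)) := by
    simp only [mul_sub]
    rw [intervalIntegral.integral_sub, hzero, sub_zero] <;>
    exact Continuous.intervalIntegrable (by fun_prop) _ _
  rw [e]
  have hU := integral_sq_le_of_integral_eq_zero hT hd hc h0
  refine (sq_intervalIntegral_le hT.le (by fun_prop)).trans ?_
  have hpt : ∀ s ∈ Set.Icc 0 T,
      (u s * (φ (W * s) - φ (W * s + v s))) ^ 2 ≤ T ^ 4 * D ^ 2 := by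
    intro s hs
    have h1 : u s ^ 2 ≤ T * D := sq_le_of_integral_eq_zero hT hd hc h0 hs
    have h2 : v s ^ 2 ≤ T * (T ^ 2 * D) := by
      have := sq_sub_le_integral_deriv_sq hvd hu hs (Set.left_mem_Icc.2 hT.le)
      simp only [hv, intervalIntegral.integral_same, sub_zero] at this
      exact this.trans (by gcongr)
    have h3 : (φ (W * s) - φ (W * s + v s)) ^ 2 ≤ v s ^ 2 := by
      rw [sq_le_sq]
      simpa using hL (W * s) (W * s + v s)
    rw [mul_pow]
    calc u s ^ 2 * (φ (W * s) - φ (W * s + v s)) ^ 2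
        ≤ (T * D) * (T * (T ^ 2 * D)) := by
          exact mul_le_mul h1 (h3.trans h2) (sq_nonneg _) (by positivity)
      _ = T ^ 4 * D ^ 2 := by ring
  have := integral_le_mul_of_le hT.le (h := fun s => (u s * (φ (W * s) - φ (W * s + v s))) ^ 2)
    (by fun_prop) hpt
  rw [sub_zero]
  calc _ ≤ T * (T * (T ^ 4 * D ^ 2)) := by gcongr
    _ = _ := by ring

theorem integral_deriv_sq_le_of_oscillator {T W : ℝ} (hT : 0 < T) (hW : 1 ≤ W)
    (hcos : cos (W * T) = 1) (hsin : sin (W * T) = 0) {u u1 u2 : ℝ → ℝ}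
    (hd : ∀ s, HasDerivAt u (u1 s) s) (hd1 : ∀ s, HasDerivAt u1 (u2 s) s) (hc : Continuous u2)
    (hp : Function.Periodic u T) :
    ∫ s in (0:ℝ)..T, u1 s ^ 2 ≤ W ^ 2 * T *
      (8 / T ^ 2 * ((∫ s in (0:ℝ)..T, u s * cos (W * s)) ^ 2
          + (∫ s in (0:ℝ)..T, u s * sin (W * s)) ^ 2)
        + 4 * T * ∫ s in (0:ℝ)..T, (u2 s + W ^ 2 * u s) ^ 2) := by
  have hW0 : 0 < W := by linarith
  have hu : Continuous u := continuous_iff_continuousAt.2 fun s => (hd s).continuousAt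
  have hu1 : Continuous u1 := continuous_iff_continuousAt.2 fun s => (hd1 s).continuousAt
  have hl (s : ℝ) : HasDerivAt (fun r => W * r) W s := by
    simpa using (hasDerivAt_id s).const_mul W
  have hC (s : ℝ) : HasDerivAt (fun r => cos (W * r)) (-sin (W * s) * W) s := (hl s).cos
  have hS (s : ℝ) : HasDerivAt (fun r => sin (W * r)) (cos (W * s) * W) s := (hl s).sin
  set P := ∫ s in (0:ℝ)..T, u s * cos (W * s) with hP
  set Q := ∫ s in (0:ℝ)..T, u s * sin (W * s) with hQ
  set F := ∫ s in (0:ℝ)..T, (u2 s + W ^ 2 * u s) ^ 2 with hF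
  set p : ℝ → ℝ := fun s => u s * cos (W * s) - u1 s * sin (W * s) / W with hpdef
  set q : ℝ → ℝ := fun s => u s * sin (W * s) + u1 s * cos (W * s) / W with hqdef
  have hpd (s : ℝ) : HasDerivAt p (-(u2 s + W ^ 2 * u s) * sin (W * s) / W) s := by
    have := ((hd s).mul (hC s)).sub (((hd1 s).mul (hS s)).div_const W)
    refine this.congr_deriv ?_
    field_simp; ring
  have hqd (s : ℝ) : HasDerivAt q ((u2 s + W ^ 2 * u s) * cos (W * s) / W) s := by
    have := ((hd s).mul (hS s)).add (((hd1 s).mul (hC s)).div_const W)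
    refine this.congr_deriv ?_
    field_simp; ring
  have hu0 : u T = u 0 := by simpa using hp 0
  have ep : ∫ s in (0:ℝ)..T, p s = 2 * P := by
    have h := intervalIntegral.integral_eq_sub_of_hasDerivAt (a := 0) (b := T)
      (fun s _ => ((hd s).mul (hS s)).div_const W)
      (Continuous.intervalIntegrable (by fun_prop) _ _)
    simp only [Pi.mul_apply, hsin, mul_zero, sin_zero, zero_div, sub_zero] at h
    have : p = fun s => 2 * (u s * cos (W * s))
        - (u1 s * sin (W * s) + u s * (cos (W * s) * W)) / W := by
      funext s; simp only [hpdef]; field_simp; ring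
    rw [this, intervalIntegral.integral_sub, h, intervalIntegral.integral_const_mul, sub_zero] <;>
    exact Continuous.intervalIntegrable (by fun_prop) _ _
  have eq : ∫ s in (0:ℝ)..T, q s = 2 * Q := by
    have h := intervalIntegral.integral_eq_sub_of_hasDerivAt (a := 0) (b := T)
      (fun s _ => ((hd s).mul (hC s)).div_const W)
      (Continuous.intervalIntegrable (by fun_prop) _ _)
    simp only [Pi.mul_apply, hcos, mul_zero, cos_zero, hu0, sub_self] at h
    have : q = fun s => 2 * (u s * sin (W * s))
        + (u1 s * cos (W * s) + u s * (-sin (W * s) * W)) / W := by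
      funext s; simp only [hqdef]; field_simp; ring
    rw [this, intervalIntegral.integral_add, h, intervalIntegral.integral_const_mul, add_zero] <;>
    exact Continuous.intervalIntegrable (by fun_prop) _ _
  have bound (c : ℝ → ℝ) (hcc : Continuous c) (hc1 : ∀ s, c s ^ 2 ≤ 1) :
      ∫ s in (0:ℝ)..T, ((u2 s + W ^ 2 * u s) * c s / W) ^ 2 ≤ F := by
    refine intervalIntegral.integral_mono_on hT.le
      (Continuous.intervalIntegrable (by fun_prop) _ _)
      (Continuous.intervalIntegrable (by fun_prop) _ _) fun s _ => ?_
    rw [div_pow, mul_pow]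
    refine (div_le_self (by positivity) (one_le_pow₀ hW)).trans ?_
    exact mul_le_of_le_one_right (sq_nonneg _) (hc1 s)
  have hpF : ∫ s in (0:ℝ)..T, (-(u2 s + W ^ 2 * u s) * sin (W * s) / W) ^ 2 ≤ F := by
    have := bound (fun s => -sin (W * s)) (by fun_prop) (fun s => by simpa using sin_sq_le_one _)
    simpa only [mul_neg, neg_mul] using this
  have hqF := bound (fun s => cos (W * s)) (by fun_prop) (fun s => cos_sq_le_one _)
  have hpt : ∀ s ∈ Set.Icc 0 T,
      u1 s ^ 2 ≤ W ^ 2 * (8 / T ^ 2 * (P ^ 2 + Q ^ 2) + 4 * T * F) := by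
    intro s hs
    have h1 := sq_sub_mean_le hT hpd (by fun_prop) hs
    have h2 := sq_sub_mean_le hT hqd (by fun_prop) hs
    rw [ep] at h1
    rw [eq] at h2
    replace h1 := h1.trans (mul_le_mul_of_nonneg_left hpF hT.le)
    replace h2 := h2.trans (mul_le_mul_of_nonneg_left hqF hT.le)
    have e1 : u1 s = W * (q s * cos (W * s) - p s * sin (W * s)) := by
      simp only [hpdef, hqdef]
      field_simp
      linear_combination (-u1 s) * sin_sq_add_cos_sq (W * s)
    have e2 : (q s * cos (W * s) - p s * sin (W * s)) ^ 2 ≤ p s ^ 2 + q s ^ 2 := by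
      have := sin_sq_add_cos_sq (W * s)
      have h : p s ^ 2 + q s ^ 2 = (q s * cos (W * s) - p s * sin (W * s)) ^ 2
          + (p s * cos (W * s) + q s * sin (W * s)) ^ 2 := by
        linear_combination (-(p s ^ 2 + q s ^ 2)) * this
      rw [h]; linarith [sq_nonneg (p s * cos (W * s) + q s * sin (W * s))]
    have e3 : p s ^ 2 ≤ 2 * (2 * P / T) ^ 2 + 2 * (T * F) := by
      nlinarith [sq_nonneg (p s - 2 * (2 * P / T))]
    have e4 : q s ^ 2 ≤ 2 * (2 * Q / T) ^ 2 + 2 * (T * F) := by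
      nlinarith [sq_nonneg (q s - 2 * (2 * Q / T))]
    rw [e1, mul_pow]
    refine mul_le_mul_of_nonneg_left (e2.trans ((add_le_add e3 e4).trans_eq ?_)) (sq_nonneg _)
    field_simp; ring
  refine (integral_le_mul_of_le hT.le (by fun_prop) hpt).trans_eq ?_
  ring

theorem integral_oscillator_sq_le {T W : ℝ} (hT : 0 < T) (hW : 1 ≤ W)
    {u u1 u2 u3 u4 : ℝ → ℝ}
    (hd : ∀ s, HasDerivAt u (u1 s) s) (hd1 : ∀ s, HasDerivAt u1 (u2 s) s)
    (hd2 : ∀ s, HasDerivAt u2 (u3 s) s) (hd3 : ∀ s, HasDerivAt u3 (u4 s) s)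
    (hc : Continuous u4) (hp : Function.Periodic u T) (hp1 : Function.Periodic u1 T)
    (hp2 : Function.Periodic u2 T) (h0 : ∫ s in (0:ℝ)..T, u s = 0)
    (hD1 : T * (∫ s in (0:ℝ)..T, u1 s ^ 2) ≤ 1)
    (hD2 : 160 * W ^ 2 * T ^ 5 * (∫ s in (0:ℝ)..T, u1 s ^ 2) ≤ 1) :
    ∫ s in (0:ℝ)..T, (u2 s + W ^ 2 * u s) ^ 2 ≤
      4 * T ^ 4 * (∫ s in (0:ℝ)..T,
        (u4 s + (W + u s) ^ 2 * u2 s - 1 / 2 * (W + u s) * u1 s ^ 2) ^ 2)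
      + 160 * W ^ 6 * T ^ 7 * (∫ s in (0:ℝ)..T, u1 s ^ 2) ^ 2 := by
  have hW0 : 0 < W := by linarith
  have hu : Continuous u := continuous_iff_continuousAt.2 fun s => (hd s).continuousAt
  have hu1 : Continuous u1 := continuous_iff_continuousAt.2 fun s => (hd1 s).continuousAt
  have hu2 : Continuous u2 := continuous_iff_continuousAt.2 fun s => (hd2 s).continuousAt
  have hu3 : Continuous u3 := continuous_iff_continuousAt.2 fun s => (hd3 s).continuousAt
  set D := ∫ s in (0:ℝ)..T, u1 s ^ 2 with hD
  set S := ∫ s in (0:ℝ)..T, u2 s ^ 2 with hS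
  set G := ∫ s in (0:ℝ)..T,
    (u4 s + (W + u s) ^ 2 * u2 s - 1 / 2 * (W + u s) * u1 s ^ 2) ^ 2 with hG
  set F := ∫ s in (0:ℝ)..T, (u2 s + W ^ 2 * u s) ^ 2 with hF
  have hD0 : 0 ≤ D := intervalIntegral.integral_nonneg hT.le fun s _ => sq_nonneg _
  have hS0 : 0 ≤ S := intervalIntegral.integral_nonneg hT.le fun s _ => sq_nonneg _
  have hG0 : 0 ≤ G := intervalIntegral.integral_nonneg hT.le fun s _ => sq_nonneg _
  have h01 : ∫ s in (0:ℝ)..T, u1 s = 0 := integral_eq_zero_of_periodic hd hu1 hp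
  have h02 : ∫ s in (0:ℝ)..T, u2 s = 0 := integral_eq_zero_of_periodic hd1 hu2 hp1
  have h03 : ∫ s in (0:ℝ)..T, u3 s = 0 := integral_eq_zero_of_periodic hd2 hu3 hp2
  have hU := integral_sq_le_of_integral_eq_zero hT hd hu1 h0
  have hK : ∫ s in (0:ℝ)..T, (u4 s + W ^ 2 * u2 s) ^ 2 ≤ 2 * G + 40 * W ^ 2 * T * D * S := by
    have hpt : ∀ s ∈ Set.Icc 0 T, (u4 s + W ^ 2 * u2 s) ^ 2 ≤
        2 * (u4 s + (W + u s) ^ 2 * u2 s - 1 / 2 * (W + u s) * u1 s ^ 2) ^ 2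
        + (36 * W ^ 2 * T * D * u2 s ^ 2 + 4 * W ^ 2 * T * S * u1 s ^ 2) := by
      intro s hs
      have b0 : u s ^ 2 ≤ T * D := sq_le_of_integral_eq_zero hT hd hu1 h0 hs
      have b1 : u1 s ^ 2 ≤ T * S := sq_le_of_integral_eq_zero hT hd1 hu2 h01 hs
      have bu : |u s| ≤ 1 := (sq_le_one_iff_abs_le_one _).1 (b0.trans hD1)
      obtain ⟨bl, br⟩ := abs_le.1 bu
      have n1 : ((2 * W * u s + u s ^ 2) * u2 s) ^ 2 ≤ 9 * W ^ 2 * (T * D) * u2 s ^ 2 := by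
        have a1 : (2 * W + u s) ^ 2 ≤ 9 * W ^ 2 := by nlinarith
        calc ((2 * W * u s + u s ^ 2) * u2 s) ^ 2
            = (2 * W + u s) ^ 2 * u s ^ 2 * u2 s ^ 2 := by ring
          _ ≤ 9 * W ^ 2 * (T * D) * u2 s ^ 2 := by gcongr
      have n2 : (1 / 2 * (W + u s) * u1 s ^ 2) ^ 2 ≤ W ^ 2 * (T * S) * u1 s ^ 2 := by
        have a1 : (1 / 2 * (W + u s)) ^ 2 ≤ W ^ 2 := by nlinarith
        calc (1 / 2 * (W + u s) * u1 s ^ 2) ^ 2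
            = (1 / 2 * (W + u s)) ^ 2 * u1 s ^ 2 * u1 s ^ 2 := by ring
          _ ≤ W ^ 2 * (T * S) * u1 s ^ 2 := by gcongr
      have e : u4 s + W ^ 2 * u2 s
          = (u4 s + (W + u s) ^ 2 * u2 s - 1 / 2 * (W + u s) * u1 s ^ 2)
            - ((2 * W * u s + u s ^ 2) * u2 s - 1 / 2 * (W + u s) * u1 s ^ 2) := by ring
      rw [e]
      generalize u4 s + (W + u s) ^ 2 * u2 s - 1 / 2 * (W + u s) * u1 s ^ 2 = g
      generalize (2 * W * u s + u s ^ 2) * u2 s = x at *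
      generalize 1 / 2 * (W + u s) * u1 s ^ 2 = y at *
      have := sq_nonneg (g + (x - y))
      have := sq_nonneg (x + y)
      nlinarith
    refine (intervalIntegral.integral_mono_on hT.le
      (Continuous.intervalIntegrable (by fun_prop) _ _)
      (Continuous.intervalIntegrable (by fun_prop) _ _) hpt).trans_eq ?_
    rw [intervalIntegral.integral_add, intervalIntegral.integral_add,
      intervalIntegral.integral_const_mul, intervalIntegral.integral_const_mul,
      intervalIntegral.integral_const_mul]
    · ring
    all_goals exact Continuous.intervalIntegrable (by fun_prop) _ _
  have hFK : F ≤ T ^ 4 * (2 * G + 40 * W ^ 2 * T * D * S) := by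
    have hf (s : ℝ) : HasDerivAt (fun s => u2 s + W ^ 2 * u s) (u3 s + W ^ 2 * u1 s) s :=
      (hd2 s).add ((hd s).const_mul _)
    have hf1 (s : ℝ) : HasDerivAt (fun s => u3 s + W ^ 2 * u1 s) (u4 s + W ^ 2 * u2 s) s :=
      (hd3 s).add ((hd1 s).const_mul _)
    have z (a b : ℝ → ℝ) (ha : Continuous a) (hb : Continuous b)
        (ha0 : ∫ s in (0:ℝ)..T, a s = 0) (hb0 : ∫ s in (0:ℝ)..T, b s = 0) :
        ∫ s in (0:ℝ)..T, (a s + W ^ 2 * b s) = 0 := by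
      rw [intervalIntegral.integral_add (ha.intervalIntegrable _ _)
        ((hb.const_mul _).intervalIntegrable _ _), intervalIntegral.integral_const_mul, ha0, hb0]
      ring
    have i1 := integral_sq_le_of_integral_eq_zero hT hf (by fun_prop) (z u2 u hu2 hu h02 h0)
    have i2 := integral_sq_le_of_integral_eq_zero hT hf1 (by fun_prop) (z u3 u1 hu3 hu1 h03 h01)
    calc F ≤ T ^ 2 * (T ^ 2 * (2 * G + 40 * W ^ 2 * T * D * S)) := by
          refine i1.trans ?_
          gcongr
          refine i2.trans ?_
          gcongr
      _ = _ := by ring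
  have hSF : S ≤ 2 * F + 2 * W ^ 4 * (T ^ 2 * D) := by
    have hpt : ∀ s ∈ Set.Icc 0 T,
        u2 s ^ 2 ≤ 2 * (u2 s + W ^ 2 * u s) ^ 2 + 2 * W ^ 4 * u s ^ 2 := by
      intro s _
      linarith [sq_nonneg (u2 s + 2 * (W ^ 2 * u s)), sq_nonneg (u2 s)]
    have := intervalIntegral.integral_mono_on hT.le
      (Continuous.intervalIntegrable (μ := volume) (by fun_prop) _ _)
      (Continuous.intervalIntegrable (by fun_prop) _ _) hpt
    rw [intervalIntegral.integral_add, intervalIntegral.integral_const_mul,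
      intervalIntegral.integral_const_mul] at this
    · refine this.trans ?_
      gcongr
    all_goals exact Continuous.intervalIntegrable (by fun_prop) _ _
  have hS2 : S ≤ 8 * T ^ 4 * G + 4 * W ^ 4 * T ^ 2 * D := by
    nlinarith [mul_le_mul_of_nonneg_right hD2 hS0]
  have hG2 : 320 * W ^ 2 * T ^ 5 * D * G ≤ 2 * G := by
    nlinarith [mul_le_mul_of_nonneg_right hD2 hG0]
  calc F ≤ T ^ 4 * (2 * G + 40 * W ^ 2 * T * D * (8 * T ^ 4 * G + 4 * W ^ 4 * T ^ 2 * D)) := by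
        refine hFK.trans ?_
        gcongr
    _ = T ^ 4 * (2 * G + 320 * W ^ 2 * T ^ 5 * D * G) + 160 * W ^ 6 * T ^ 7 * D ^ 2 := by ring
    _ ≤ T ^ 4 * (2 * G + 2 * G) + 160 * W ^ 6 * T ^ 7 * D ^ 2 := by gcongr
    _ = _ := by ring

theorem integral_mul_trig_tangentAngle_eq_zero {T W : ℝ} {u x y : ℝ → ℝ} (hu : Continuous u)
    (hx : ∀ s, HasDerivAt x (-((W + u s) * y s)) s) (hy : ∀ s, HasDerivAt y ((W + u s) * x s) s)
    (hxy : ∀ s, x s ^ 2 + y s ^ 2 = 1) (hxp : Function.Periodic x T)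
    (hyp : Function.Periodic y T) (hx0 : ∫ s in (0:ℝ)..T, x s = 0)
    (hy0 : ∫ s in (0:ℝ)..T, y s = 0) :
    ∫ s in (0:ℝ)..T, u s * cos (W * s + ∫ r in (0:ℝ)..s, u r) = 0 ∧
      ∫ s in (0:ℝ)..T, u s * sin (W * s + ∫ r in (0:ℝ)..s, u r) = 0 := by
  have hxc : Continuous x := continuous_iff_continuousAt.2 fun s => (hx s).continuousAt
  have hyc : Continuous y := continuous_iff_continuousAt.2 fun s => (hy s).continuousAt
  set θ : ℝ → ℝ := fun s => W * s + ∫ r in (0:ℝ)..s, u r with hθ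
  have hθd (s : ℝ) : HasDerivAt θ (W + u s) s := by
    have h1 : HasDerivAt (fun r => W * r) W s := by simpa using (hasDerivAt_id s).const_mul W
    exact h1.add (hu.integral_hasStrictDerivAt 0 s).hasDerivAt
  have hc (s : ℝ) : HasDerivAt (fun r => x r * cos (θ r) + y r * sin (θ r)) 0 s := by
    refine (((hx s).mul (hθd s).cos).add ((hy s).mul (hθd s).sin)).congr_deriv ?_
    ring
  have hd (s : ℝ) : HasDerivAt (fun r => y r * cos (θ r) - x r * sin (θ r)) 0 s := by
    refine (((hy s).mul (hθd s).cos).sub ((hx s).mul (hθd s).sin)).congr_deriv ?_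
    ring
  have hcc (s : ℝ) := is_const_of_deriv_eq_zero (fun s => (hc s).differentiableAt)
    (fun s => (hc s).deriv) s 0
  have hdc (s : ℝ) := is_const_of_deriv_eq_zero (fun s => (hd s).differentiableAt)
    (fun s => (hd s).deriv) s 0
  generalize x 0 * cos (θ 0) + y 0 * sin (θ 0) = c at hcc
  generalize y 0 * cos (θ 0) - x 0 * sin (θ 0) = d at hdc
  have hux : ∫ s in (0:ℝ)..T, u s * x s = 0 := by
    have h := integral_eq_zero_of_periodic hy (by fun_prop) hyp
    simp only [add_mul] at h
    rwa [intervalIntegral.integral_add, intervalIntegral.integral_const_mul, hx0, mul_zero,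
      zero_add] at h <;>
    exact Continuous.intervalIntegrable (by fun_prop) _ _
  have huy : ∫ s in (0:ℝ)..T, u s * y s = 0 := by
    have h := integral_eq_zero_of_periodic hx (by fun_prop) hxp
    rw [intervalIntegral.integral_neg, neg_eq_zero] at h
    simp only [add_mul] at h
    rwa [intervalIntegral.integral_add, intervalIntegral.integral_const_mul, hy0, mul_zero,
      zero_add] at h <;>
    exact Continuous.intervalIntegrable (by fun_prop) _ _
  have comb (a b : ℝ) : ∫ s in (0:ℝ)..T, (a * (u s * x s) + b * (u s * y s)) = 0 := by
    rw [intervalIntegral.integral_add, intervalIntegral.integral_const_mul,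
      intervalIntegral.integral_const_mul, hux, huy]
    · ring
    all_goals exact Continuous.intervalIntegrable (by fun_prop) _ _
  constructor
  · refine Eq.trans (intervalIntegral.integral_congr fun s _ => ?_) (comb c d)
    linear_combination (-(u s * cos (θ s))) * hxy s + (u s * x s) * hcc s + (u s * y s) * hdc s
  · refine Eq.trans (intervalIntegral.integral_congr fun s _ => ?_) (comb (-d) c)
    linear_combination (-(u s * sin (θ s))) * hxy s + (u s * y s) * hcc s - (u s * x s) * hdc s

theorem integral_deriv_sq_le_of_small {T W : ℝ} (hT : 0 < T) (hW : 1 ≤ W)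
    (hcos : cos (W * T) = 1) (hsin : sin (W * T) = 0) {x y u u1 u2 u3 u4 : ℝ → ℝ}
    (hx : ∀ s, HasDerivAt x (-((W + u s) * y s)) s) (hy : ∀ s, HasDerivAt y ((W + u s) * x s) s)
    (hxy : ∀ s, x s ^ 2 + y s ^ 2 = 1) (hxp : Function.Periodic x T)
    (hyp : Function.Periodic y T) (hx0 : ∫ s in (0:ℝ)..T, x s = 0)
    (hy0 : ∫ s in (0:ℝ)..T, y s = 0)
    (hd : ∀ s, HasDerivAt u (u1 s) s) (hd1 : ∀ s, HasDerivAt u1 (u2 s) s)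
    (hd2 : ∀ s, HasDerivAt u2 (u3 s) s) (hd3 : ∀ s, HasDerivAt u3 (u4 s) s)
    (hc : Continuous u4) (hp : Function.Periodic u T) (hp1 : Function.Periodic u1 T)
    (hp2 : Function.Periodic u2 T) (h0 : ∫ s in (0:ℝ)..T, u s = 0)
    (hsmall : (T + 160 * W ^ 2 * T ^ 5 + 2 * (W ^ 2 * (16 * T ^ 5 + 640 * W ^ 6 * T ^ 9)))
      * (∫ s in (0:ℝ)..T, u1 s ^ 2) ≤ 1) :
    ∫ s in (0:ℝ)..T, u1 s ^ 2 ≤ 32 * W ^ 2 * T ^ 6 * (∫ s in (0:ℝ)..T,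
        (u4 s + (W + u s) ^ 2 * u2 s - 1 / 2 * (W + u s) * u1 s ^ 2) ^ 2) := by
  have hu : Continuous u := continuous_iff_continuousAt.2 fun s => (hd s).continuousAt
  have hu1 : Continuous u1 := continuous_iff_continuousAt.2 fun s => (hd1 s).continuousAt
  have hu2 : Continuous u2 := continuous_iff_continuousAt.2 fun s => (hd2 s).continuousAt
  obtain ⟨hzc, hzs⟩ := integral_mul_trig_tangentAngle_eq_zero hu hx hy hxy hxp hyp hx0 hy0
  have hP := sq_integral_mul_comp_le hT hd hu1 h0 continuous_cos abs_cos_sub_cos_le hzc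
  have hQ := sq_integral_mul_comp_le hT hd hu1 h0 continuous_sin abs_sin_sub_sin_le hzs
  have hosc := integral_deriv_sq_le_of_oscillator hT hW hcos hsin hd hd1 hu2 hp
  have hD0 : 0 ≤ ∫ s in (0:ℝ)..T, u1 s ^ 2 :=
    intervalIntegral.integral_nonneg hT.le fun s _ => sq_nonneg _
  set D := ∫ s in (0:ℝ)..T, u1 s ^ 2 with hD
  have p1 : 0 ≤ T * D := by positivity
  have p2 : 0 ≤ 160 * W ^ 2 * T ^ 5 * D := by positivity
  have p3 : 0 ≤ 2 * (W ^ 2 * (16 * T ^ 5 + 640 * W ^ 6 * T ^ 9)) * D := by positivity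
  have hF := integral_oscillator_sq_le hT hW hd hd1 hd2 hd3 hc hp hp1 hp2 h0
    (by linarith) (by linarith)
  rw [← hD] at hF
  set G := ∫ s in (0:ℝ)..T,
    (u4 s + (W + u s) ^ 2 * u2 s - 1 / 2 * (W + u s) * u1 s ^ 2) ^ 2 with hG
  have hbD : W ^ 2 * (16 * T ^ 5 + 640 * W ^ 6 * T ^ 9) * D * D ≤ 1 / 2 * D :=
    mul_le_mul_of_nonneg_right (by linarith) hD0
  have : D ≤ 16 * W ^ 2 * T ^ 6 * G + W ^ 2 * (16 * T ^ 5 + 640 * W ^ 6 * T ^ 9) * D * D := by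
    calc D ≤ W ^ 2 * T * (8 / T ^ 2 * (T ^ 6 * D ^ 2 + T ^ 6 * D ^ 2)
          + 4 * T * (4 * T ^ 4 * G + 160 * W ^ 6 * T ^ 7 * D ^ 2)) := by
          refine hosc.trans ?_
          gcongr
      _ = _ := by field_simp; ring
  linarith

theorem Function.Periodic.deriv_periodic {E : Type*} [NormedAddCommGroup E] [NormedSpace ℝ E]
    {f : ℝ → E} {c : ℝ} (hf : Function.Periodic f c) : Function.Periodic (deriv f) c := by
  intro s
  rw [← deriv_comp_add_const]
  exact congrArg (fun g => deriv g s) (funext hf)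

theorem hasDerivAt_iteratedDeriv {f : ℝ → ℝ} (hf : ContDiff ℝ (⊤ : ℕ∞) f) (n : ℕ) (s : ℝ) :
    HasDerivAt (iteratedDeriv n f) (iteratedDeriv (n + 1) f s) s := by
  rw [iteratedDeriv_succ]
  exact ((hf.differentiable_iteratedDeriv n
    (by exact_mod_cast WithTop.coe_lt_top n)) s).hasDerivAt

theorem integral_comp_scale {l T L : ℝ} (hl : l ≠ 0) (hL : l * T = L) (h : ℝ → ℝ) :
    ∫ s in (0:ℝ)..T, h (l * s) = l⁻¹ * ∫ s in (0:ℝ)..L, h s := by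
  rw [intervalIntegral.integral_comp_mul_left _ hl, mul_zero, hL, smul_eq_mul]

/-- There exist constants `Ĉ_ω, ε₀ > 0` depending only on `ω` such that
every smooth closed immersed planar curve with winding number `ω` and `L³E < ε₀`
satisfies `∫ K² ds ≥ Ĉ_ω L⁻⁶ E`, where `E = ½∫ k_s² ds`. -/
theorem EL_lower_bound_small_energy (ω : ℕ) (hω : 1 ≤ ω) :
    ∃ Chat : ℝ, 0 < Chat ∧ ∃ ε₀ : ℝ, 0 < ε₀ ∧
      ∀ (γ : ℝ → EuclideanSpace ℝ (Fin 2)) (k : ℝ → ℝ) (L : ℝ),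
        0 < L → ContDiff ℝ (⊤ : ℕ∞) γ → ContDiff ℝ (⊤ : ℕ∞) k →
        Function.Periodic γ L →
        (∀ s : ℝ, ‖deriv γ s‖ = 1) →
        (∀ s : ℝ, deriv (deriv γ) s = k s • rot2 (deriv γ s)) →
        (∫ s in (0:ℝ)..L, k s) = 2 * π * ω →
        L ^ 3 * ((1 / 2) * ∫ s in (0:ℝ)..L, (deriv k s) ^ 2) < ε₀ →
        Chat * ((1 / 2) * ∫ s in (0:ℝ)..L, (deriv k s) ^ 2) / L ^ 6 ≤
          ∫ s in (0:ℝ)..L, (Kop1 k s) ^ 2 := by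
  have hπ := pi_pos
  set T : ℝ := 2 * π with hTdef
  have hT : 0 < T := by positivity
  set W : ℝ := (ω : ℝ) with hWdef
  have hW : 1 ≤ W := Nat.one_le_cast.2 hω
  have hW0 : 0 < W := by linarith
  set b : ℝ := T + 160 * W ^ 2 * T ^ 5 + 2 * (W ^ 2 * (16 * T ^ 5 + 640 * W ^ 6 * T ^ 9)) with hb
  have hb0 : 0 < b := by positivity
  refine ⟨1 / (16 * W ^ 2), by positivity, T ^ 3 / (2 * b), by positivity, ?_⟩
  intro γ k L hL hγ hk hper hunit hcurv hwind hsmall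
  set l : ℝ := L / T with hl
  have hl0 : 0 < l := by positivity
  have hlT : l * T = L := by rw [hl]; field_simp
  have hγd (s : ℝ) : HasDerivAt γ (deriv γ s) s :=
    ((hγ.differentiable (by simp)) s).hasDerivAt
  have hγ1 : ContDiff ℝ (⊤ : ℕ∞) (deriv γ) := (contDiff_infty_iff_deriv.1 hγ).2
  have hγdd (s : ℝ) : HasDerivAt (deriv γ) (k s • rot2 (deriv γ s)) s := by
    rw [← hcurv s]
    exact ((hγ1.differentiable (by simp)) s).hasDerivAt
  have hcoord (f : ℝ → EuclideanSpace ℝ (Fin 2)) (f' : EuclideanSpace ℝ (Fin 2)) (s : ℝ)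
      (hf : HasDerivAt f f' s) (i : Fin 2) : HasDerivAt (fun r => f r i) (f' i) s :=
    (EuclideanSpace.proj i : EuclideanSpace ℝ (Fin 2) →L[ℝ] ℝ).hasFDerivAt.comp_hasDerivAt s hf
  have hX (s : ℝ) : HasDerivAt (fun r => deriv γ r 0) (-(k s * deriv γ s 1)) s :=
    (hcoord _ _ s (hγdd s) 0).congr_deriv (by simp [rot2])
  have hY (s : ℝ) : HasDerivAt (fun r => deriv γ r 1) (k s * deriv γ s 0) s :=
    (hcoord _ _ s (hγdd s) 1).congr_deriv (by simp [rot2])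
  have hXY (s : ℝ) : deriv γ s 0 ^ 2 + deriv γ s 1 ^ 2 = 1 := by
    have := EuclideanSpace.norm_sq_eq (deriv γ s)
    rw [hunit s] at this
    simpa [Fin.sum_univ_two] using this.symm
  have hper1 : Function.Periodic (deriv γ) L := hper.deriv_periodic
  have hkp : Function.Periodic k L := by
    have e (s : ℝ) : k s = deriv γ s 0 * deriv (deriv γ) s 1
        - deriv γ s 1 * deriv (deriv γ) s 0 := by
      rw [hcurv s]
      simp only [rot2, PiLp.smul_apply, smul_eq_mul, WithLp.equiv_symm_apply,
        Matrix.cons_val_zero, Matrix.cons_val_one]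
      linear_combination (-k s) * hXY s
    intro s
    rw [e, e, hper1 s, hper1.deriv_periodic s]
  have hγ1c : Continuous (deriv γ) := hγ1.continuous
  have hint (i : Fin 2) : ∫ s in (0:ℝ)..L, deriv γ s i = 0 :=
    integral_eq_zero_of_periodic (fun s => hcoord _ _ s (hγd s) i) (by fun_prop)
      fun s => congrArg (fun p => p i) (hper s)
  have hscale {f f' : ℝ → ℝ} (c : ℝ) (hf : ∀ s, HasDerivAt f (f' s) s) (t : ℝ) :
      HasDerivAt (fun r => c * f (l * r)) (c * l * f' (l * t)) t := by
    have h1 : HasDerivAt (fun r => l * r) l t := by simpa using (hasDerivAt_id t).const_mul l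
    exact (((hf (l * t)).comp t h1).const_mul c).congr_deriv (by ring)
  have hpscale {E : Type} {f : ℝ → E} (hf : Function.Periodic f L) :
      Function.Periodic (fun t => f (l * t)) T := by
    intro t
    simp only [mul_add, hlT, hf (l * t)]
  have hkd := hasDerivAt_iteratedDeriv hk
  have hkd0 (s : ℝ) : HasDerivAt k (deriv k s) s := by
    simpa using hkd 0 s
  have hkd1 (s : ℝ) : HasDerivAt (deriv k) (iteratedDeriv 2 k s) s := by
    simpa using hkd 1 s
  have hkp1 : Function.Periodic (deriv k) L := hkp.deriv_periodic
  have hkp2 : Function.Periodic (iteratedDeriv 2 k) L := by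
    rw [iteratedDeriv_succ, iteratedDeriv_one]
    exact hkp1.deriv_periodic
  have hk4 : Continuous (iteratedDeriv 4 k) :=
    continuous_iff_continuousAt.2 fun s => (hkd 4 s).continuousAt
  have hkc : Continuous k := hk.continuous
  have hDscale : ∫ t in (0:ℝ)..T, (l * l * deriv k (l * t)) ^ 2
      = l ^ 3 * ∫ s in (0:ℝ)..L, deriv k s ^ 2 := by
    rw [integral_comp_scale hl0.ne' hlT (fun s => (l * l * deriv k s) ^ 2)]
    simp only [mul_pow]
    rw [intervalIntegral.integral_const_mul]
    field_simp
  have hGscale : ∫ t in (0:ℝ)..T, (l * l * l * l * l * iteratedDeriv 4 k (l * t)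
        + (W + (l * k (l * t) - W)) ^ 2 * (l * l * l * iteratedDeriv 2 k (l * t))
        - 1 / 2 * (W + (l * k (l * t) - W)) * (l * l * deriv k (l * t)) ^ 2) ^ 2
      = l ^ 9 * ∫ s in (0:ℝ)..L, Kop1 k s ^ 2 := by
    have e : (fun t => (l * l * l * l * l * iteratedDeriv 4 k (l * t)
        + (W + (l * k (l * t) - W)) ^ 2 * (l * l * l * iteratedDeriv 2 k (l * t))
        - 1 / 2 * (W + (l * k (l * t) - W)) * (l * l * deriv k (l * t)) ^ 2) ^ 2)
        = fun t => (fun s => l ^ 10 * Kop1 k s ^ 2) (l * t) := by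
      funext t; simp only [Kop1]; ring
    rw [e, integral_comp_scale hl0.ne' hlT (fun s => l ^ 10 * Kop1 k s ^ 2),
      intervalIntegral.integral_const_mul]
    field_simp
  have hcos : cos (W * T) = 1 := cos_nat_mul_two_pi ω
  have hsin : sin (W * T) = 0 := by
    have := sin_nat_mul_pi (2 * ω)
    push_cast at this
    rw [← this]; congr 1; rw [hTdef]; ring
  have main := integral_deriv_sq_le_of_small (u := fun t => l * k (l * t) - W) hT hW hcos hsin
    (fun t => by simpa [mul_assoc] using hscale 1 hX t)
    (fun t => by simpa [mul_assoc] using hscale 1 hY t)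
    (fun t => hXY (l * t))
    (fun t => by simp only [hpscale hper1 t])
    (fun t => by simp only [hpscale hper1 t])
    (by rw [integral_comp_scale hl0.ne' hlT (fun s => deriv γ s 0), hint 0, mul_zero])
    (by rw [integral_comp_scale hl0.ne' hlT (fun s => deriv γ s 1), hint 1, mul_zero])
    (fun t => (hscale l hkd0 t).sub_const W)
    (hscale (l * l) hkd1) (hscale (l * l * l) (hkd 2)) (hscale (l * l * l * l) (hkd 3))
    (by fun_prop)
    (fun t => by simp only [hpscale hkp t])
    (fun t => by simp only [hpscale hkp1 t])
    (fun t => by simp only [hpscale hkp2 t])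
    (by
      rw [intervalIntegral.integral_sub (Continuous.intervalIntegrable (by fun_prop) _ _)
        (continuous_const.intervalIntegrable _ _), intervalIntegral.integral_const_mul,
        integral_comp_scale hl0.ne' hlT, hwind, intervalIntegral.integral_const, smul_eq_mul]
      field_simp; ring)
    (by
      rw [hDscale, ← hb]
      rw [lt_div_iff₀ (by positivity)] at hsmall
      rw [hl, div_pow, ← mul_div_right_comm, ← mul_div_assoc, div_le_one (by positivity)]
      linarith)
  rw [hDscale, hGscale] at main
  have hmain : ∫ s in (0:ℝ)..L, deriv k s ^ 2
      ≤ 32 * W ^ 2 * T ^ 6 * l ^ 6 * ∫ s in (0:ℝ)..L, Kop1 k s ^ 2 := by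
    refine le_of_mul_le_mul_left (main.trans_eq ?_) (pow_pos hl0 3)
    ring
  rw [div_le_iff₀ (by positivity), div_mul_eq_mul_div, div_le_iff₀ (by positivity)]
  rw [← hlT, mul_pow]
  rw [← hlT] at hmain
  linarith
end
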